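/- arXiv:2603.24499 — 3 statements merged into one kernel-verified Lean document; each statement's English description precedes it below -/
import Mathlib

section
/- Let G be a finitely generated group and assume hypothesis (★) holds. Then for every real β > −α, as u → 0⁺ one has the asymptotic equivalence W_β(u) ∼ (Γ(α+β)·γ/(m−1)!) · u^{−(α+β)} · (−ln u)^{m−1}, i.e. the ratio of the two sides tends to 1. -/
open scoped BigOperators

/-- `a_n(G)`: the number of subgroups of `G` of index exactly `n`. -/
noncomputable def aCount (G : Type*) [Group G] (n : ℕ) : ℕ :=
  Nat.card {H : Subgroup G // H.index = n}

/-- `W_β(u) = ∑_{δ ≥ 1} δ^β a_δ(G) e^{-δu}`. -/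
noncomputable def Wfun (G : Type*) [Group G] (β : ℝ) (u : ℝ) : ℝ :=
  ∑' δ : ℕ, ((δ : ℝ) + 1) ^ β * (aCount G (δ + 1) : ℝ) * Real.exp (-((δ : ℝ) + 1) * u)

section

open MeasureTheory Filter Topology FourierTransform

lemma one_add_abs_sub_le (x s : ℝ) : 1 + |x - s| ≤ (1 + |x|) * (1 + |s|) := by
  have := abs_sub x s
  nlinarith [abs_nonneg x, abs_nonneg s, mul_nonneg (abs_nonneg x) (abs_nonneg s)]

/-- A function of rapid decay, in the weak sense that involves no derivatives. -/
def RapidDecay (f : ℝ → ℝ) : Prop := ∀ N : ℕ, ∃ C : ℝ, ∀ t, |f t| * (1 + |t|) ^ N ≤ C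

lemma integrable_inv_one_add_abs_sq : Integrable fun t : ℝ => ((1 + |t|) ^ 2)⁻¹ := by
  have := integrable_one_add_norm (E := ℝ) (μ := volume) (r := 2) (by simp)
  refine this.congr (Eventually.of_forall fun t => ?_)
  simp only [Real.norm_eq_abs]
  rw [Real.rpow_neg (by positivity)]
  norm_num

lemma RapidDecay.integrable_mul {f : ℝ → ℝ} (hf : RapidDecay f) (hc : Continuous f) (N : ℕ) :
    Integrable fun t => f t * (1 + |t|) ^ N := by
  obtain ⟨C, hC⟩ := hf (N + 2)
  refine (integrable_inv_one_add_abs_sq.const_mul C).mono' (by fun_prop)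
    (Eventually.of_forall fun t => ?_)
  rw [norm_mul, norm_pow, Real.norm_eq_abs, Real.norm_eq_abs, abs_of_nonneg (by positivity : 0 ≤ 1 + |t|),
    ← div_eq_mul_inv, le_div_iff₀ (by positivity), mul_assoc, ← pow_add]
  exact hC t

lemma RapidDecay.integrable {f : ℝ → ℝ} (hf : RapidDecay f) (hc : Continuous f) :
    Integrable f := by
  simpa using hf.integrable_mul hc 0

/-- Nonnegative rapidly decreasing functions with compactly supported Fourier transform. -/
structure BandLimitedKernel (φ : ℝ → ℝ) : Prop where
  nonneg : ∀ t, 0 ≤ φ t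
  continuous : Continuous φ
  decay : RapidDecay φ
  band : ∃ ψ : ℝ → ℂ, Continuous ψ ∧ HasCompactSupport ψ ∧ ∀ t, 𝓕 ψ t = (φ t : ℂ)

lemma BandLimitedKernel.const_mul {φ : ℝ → ℝ} (h : BandLimitedKernel φ) {c : ℝ} (hc : 0 ≤ c) :
    BandLimitedKernel fun t => c * φ t where
  nonneg t := mul_nonneg hc (h.nonneg t)
  continuous := by have := h.continuous; fun_prop
  decay N := by
    obtain ⟨C, hC⟩ := h.decay N
    refine ⟨c * C, fun t => ?_⟩
    rw [abs_mul, abs_of_nonneg hc, mul_assoc]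
    exact mul_le_mul_of_nonneg_left (hC t) hc
  band := by
    obtain ⟨ψ, hψ, hs, he⟩ := h.band
    refine ⟨fun t => c * ψ t, by fun_prop, hs.mul_left, fun t => ?_⟩
    have := he t
    rw [Real.fourier_real_eq_integral_exp_smul] at this ⊢
    rw [Complex.ofReal_mul, ← this, ← integral_const_mul]
    congr 1; ext v
    simp only [smul_eq_mul]; ring

lemma BandLimitedKernel.comp_mul {φ : ℝ → ℝ} (h : BandLimitedKernel φ) {R : ℝ} (hR : 1 ≤ R) :
    BandLimitedKernel fun t => R * φ (R * t) := by
  have hR0 : 0 < R := by linarith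
  refine BandLimitedKernel.const_mul (φ := fun t => φ (R * t)) ⟨fun t => h.nonneg _, ?_, ?_, ?_⟩ hR0.le
  · have := h.continuous; fun_prop
  · intro N
    obtain ⟨C, hC⟩ := h.decay N
    refine ⟨C, fun t => le_trans ?_ (hC (R * t))⟩
    have : |t| ≤ |R * t| := by
      rw [abs_mul, abs_of_pos hR0]; nlinarith [abs_nonneg t]
    gcongr
  · obtain ⟨ψ, hψ, hs, he⟩ := h.band
    refine ⟨fun t => (R : ℂ)⁻¹ * ψ (R⁻¹ * t), by fun_prop, ?_, fun t => ?_⟩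
    · exact (hs.comp_homeomorph (Homeomorph.mulLeft₀ R⁻¹ (by positivity))).mul_left
    · have := he (R * t)
      rw [Real.fourier_real_eq_integral_exp_smul] at this ⊢
      rw [← this]
      have key := Measure.integral_comp_mul_left
        (fun v : ℝ => Complex.exp (↑(-2 * Real.pi * v * (R * t)) * Complex.I) • ψ v) R⁻¹
      simp only [inv_inv, abs_of_pos hR0] at key
      have e : ∀ v : ℝ, Complex.exp (↑(-2 * Real.pi * v * t) * Complex.I) • ((R : ℂ)⁻¹ * ψ (R⁻¹ * v))
         = (R : ℂ)⁻¹ * (Complex.exp (↑(-2 * Real.pi * (R⁻¹ * v) * (R * t)) * Complex.I) • ψ (R⁻¹ * v)) := by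
        intro v
        have : (-2 * Real.pi * (R⁻¹ * v) * (R * t)) = -2 * Real.pi * v * t := by field_simp
        rw [this]; simp only [smul_eq_mul]; ring
      simp_rw [e]
      rw [integral_const_mul, key, Complex.real_smul, ← mul_assoc, inv_mul_cancel₀ (by exact_mod_cast hR0.ne'), one_mul]

lemma exists_bandLimitedKernel : ∃ φ, BandLimitedKernel φ ∧ ∫ t, φ t = 1 := by
  let b : ContDiffBump (0 : ℝ) := ⟨1, 2, by norm_num, by norm_num⟩
  have hbs : ContDiff ℝ (⊤ : ℕ∞) (fun t => (b t : ℂ)) :=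
    Complex.ofRealCLM.contDiff.comp b.contDiff
  have hbc : HasCompactSupport (fun t => (b t : ℂ)) :=
    b.hasCompactSupport.comp_left (g := fun t : ℝ => (t : ℂ)) (by simp)
  let f : SchwartzMap ℝ ℂ := hbc.toSchwartzMap hbs
  have hf : ∀ t, f t = (b t : ℂ) := fun t => rfl
  let g := SchwartzMap.convolution (ContinuousLinearMap.mul ℂ ℂ) f f
  have hFg : ∀ t, 𝓕 (g : ℝ → ℂ) t = 𝓕 (f : ℝ → ℂ) t * 𝓕 (f : ℝ → ℂ) t := by
    intro t
    rw [← SchwartzMap.fourier_coe, SchwartzMap.fourier_convolution, ]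
    simp [SchwartzMap.pairing_apply_apply, SchwartzMap.fourier_coe]
  have hconj : ∀ t, (starRingEnd ℂ) (𝓕 (f : ℝ → ℂ) t) = 𝓕 (f : ℝ → ℂ) t := by
    intro t
    rw [Real.fourier_real_eq_integral_exp_smul, ← integral_conj, ← integral_neg_eq_self]
    congr 1; ext v
    simp only [smul_eq_mul, map_mul, hf, Complex.conj_ofReal, b.neg, ← Complex.exp_conj, Complex.conj_I]
    congr 2
    push_cast; ring
  have hre : ∀ t, 𝓕 (f : ℝ → ℂ) t = ((𝓕 (f : ℝ → ℂ) t).re : ℂ) := fun t =>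
    (Complex.conj_eq_iff_re.mp (hconj t)).symm
  let φ : ℝ → ℝ := fun t => (𝓕 (f : ℝ → ℂ) t).re ^ 2
  have hφ : ∀ t, 𝓕 (g : ℝ → ℂ) t = (φ t : ℂ) := by
    intro t
    rw [hFg, hre t]
    simp only [φ]; push_cast; ring
  have hφn : ∀ t, |φ t| = ‖(𝓕 g) t‖ := by
    intro t
    rw [SchwartzMap.fourier_coe, hφ, Complex.norm_real, Real.norm_eq_abs]
  have hφc : Continuous φ := by
    have : Continuous (𝓕 (f : ℝ → ℂ)) := by
      rw [← SchwartzMap.fourier_coe]; exact (𝓕 f).continuous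
    simp only [φ]; fun_prop
  have hk : BandLimitedKernel φ := by
    refine ⟨fun t => sq_nonneg _, hφc, fun N => ?_, g, g.continuous, ?_, hφ⟩
    · have := SchwartzMap.one_add_le_sup_seminorm_apply (𝕜 := ℝ) (m := (N, 0)) (k := N) (n := 0)
        le_rfl le_rfl (𝓕 g)
      simp_rw [norm_iteratedFDeriv_zero, ← hφn, mul_comm _ |φ _|, Real.norm_eq_abs] at this
      exact ⟨_, this⟩
    · have : (g : ℝ → ℂ) = MeasureTheory.convolution f f (ContinuousLinearMap.mul ℂ ℂ) volume := by
        ext x; exact SchwartzMap.convolution_apply _ _ _ _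
      rw [this]
      exact HasCompactSupport.convolution _ hbc hbc
  have h0 : 0 < φ 0 := by
    have : 𝓕 (f : ℝ → ℂ) 0 = ((∫ t, b t : ℝ) : ℂ) := by
      rw [Real.fourier_real_eq_integral_exp_smul, ← integral_complex_ofReal]
      simp [hf]
    simp only [φ]
    rw [this, Complex.ofReal_re]
    exact pow_pos b.integral_pos 2
  have hpos : 0 < ∫ t, φ t := by
    exact integral_pos_of_integrable_nonneg_nonzero hφc (hk.decay.integrable hφc) hk.nonneg h0.ne'
  refine ⟨_, hk.const_mul (inv_nonneg.2 hpos.le), ?_⟩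
  rw [integral_const_mul, inv_mul_cancel₀ hpos.ne']

lemma integral_mul_fourier {X : Type*} [MeasurableSpace X] {μ : Measure X} [SFinite μ]
    {q : X → ℂ} (hq : Integrable q μ) {Y : X → ℝ} (hY : Measurable Y) {ψ : ℝ → ℂ}
    (hψ : Integrable ψ) (x : ℝ) :
    ∫ a, q a * 𝓕 ψ (x - Y a) ∂μ =
      𝓕 (fun τ => ψ τ * ∫ a, q a * Complex.exp (2 * Real.pi * τ * Y a * Complex.I) ∂μ) x := by
  simp_rw [Real.fourier_real_eq_integral_exp_smul, smul_eq_mul, ← integral_const_mul]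
  rw [integral_integral_swap]
  · congr 1; ext τ; congr 1; ext a
    rw [show (↑(-2 * Real.pi * τ * (x - Y a)) * Complex.I : ℂ) =
      ↑(-2 * Real.pi * τ * x) * Complex.I + 2 * Real.pi * τ * Y a * Complex.I by push_cast; ring,
      Complex.exp_add]
    ring
  · refine (hq.mul_prod hψ).mono ?_ (Eventually.of_forall fun z => ?_)
    · have h1 : Measurable fun z : X × ℝ => Complex.exp (↑(-2 * Real.pi * z.2 * (x - Y z.1)) * Complex.I) := by
        fun_prop
      exact (hq.aestronglyMeasurable.comp_fst).mul (h1.aestronglyMeasurable.mul hψ.aestronglyMeasurable.comp_snd)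
    · simp only [Function.uncurry, norm_mul, Complex.norm_exp_ofReal_mul_I, one_mul, le_refl]

lemma integrableOn_pow_mul_exp_neg (j : ℕ) {ε : ℝ} (hε : 0 < ε) :
    IntegrableOn (fun t : ℝ => t ^ j * Real.exp (-(ε * t))) (Set.Ioi 0) := by
  have := integrableOn_rpow_mul_exp_neg_mul_rpow (p := 1) (s := j) (b := ε)
    (by have : (0:ℝ) ≤ j := by positivity
        linarith) one_pos hε
  refine this.congr_fun (fun t ht => ?_) measurableSet_Ioi
  simp

lemma integrableOn_pow_mul_cexp_neg (j : ℕ) {z : ℂ} (hz : 0 < z.re) :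
    IntegrableOn (fun t : ℝ => (t : ℂ) ^ j * Complex.exp (-(z * t))) (Set.Ioi 0) := by
  refine (integrableOn_pow_mul_exp_neg j hz).mono' (by fun_prop)
    ((ae_restrict_mem measurableSet_Ioi).mono fun t ht => ?_)
  rw [norm_mul, norm_pow, Complex.norm_exp, Complex.norm_real, Real.norm_of_nonneg ht.le]
  simp

lemma integral_pow_mul_cexp_neg (j : ℕ) {z : ℂ} (hz : 0 < z.re) :
    ∫ t : ℝ in Set.Ioi 0, (t : ℂ) ^ j * Complex.exp (-(z * t)) = j.factorial / z ^ (j + 1) := by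
  have hz0 : z ≠ 0 := by rintro rfl; simp at hz
  induction j with
  | zero =>
    have := integral_exp_mul_complex_Ioi (a := -z) (by simpa using hz) 0
    simp only [neg_mul, pow_zero, one_mul] at this ⊢
    rw [this]; simp
  | succ j ih =>
    have hd : ∀ t ∈ Set.Ici (0 : ℝ), HasDerivAt (fun t : ℝ => -((t : ℂ) ^ (j + 1) * Complex.exp (-(z * t))) / z)
        ((t : ℂ) ^ (j + 1) * Complex.exp (-(z * t)) - (j + 1) / z * ((t : ℂ) ^ j * Complex.exp (-(z * t)))) t := by
      intro t _
      have h1 : HasDerivAt (fun t : ℂ => -(t ^ (j + 1) * Complex.exp (-(z * t))) / z) _ (t : ℂ) :=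
        (((hasDerivAt_pow (j + 1) (t : ℂ)).mul (((hasDerivAt_id (t : ℂ)).const_mul z).neg.cexp)).neg).div_const z
      convert! h1.comp_ofReal using 1
      simp only [id, add_tsub_cancel_right, Pi.neg_apply]
      push_cast
      field_simp
      ring
    have hi := integrableOn_pow_mul_cexp_neg (j + 1) hz
    have hi' := (integrableOn_pow_mul_cexp_neg j hz).const_mul (((j : ℂ) + 1) / z)
    have hlim : Tendsto (fun t : ℝ => -((t : ℂ) ^ (j + 1) * Complex.exp (-(z * t))) / z) atTop (𝓝 0) := by
      have h0 := ((Real.tendsto_pow_mul_exp_neg_atTop_nhds_zero (j + 1)).comp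
        (tendsto_id.const_mul_atTop hz)).const_mul ((z.re ^ (j + 1))⁻¹ / ‖z‖)
      rw [mul_zero] at h0
      refine squeeze_zero_norm' ?_ h0
      filter_upwards [eventually_ge_atTop 0] with t ht
      rw [norm_div, norm_neg, norm_mul, norm_pow, Complex.norm_exp, Complex.norm_real,
        Real.norm_of_nonneg ht]
      simp only [Function.comp_apply, id, mul_pow, Complex.neg_re, Complex.re_mul_ofReal]
      apply le_of_eq
      field_simp
    have key := integral_Ioi_of_hasDerivAt_of_tendsto' hd (hi.sub hi') hlim
    rw [integral_sub hi hi', integral_const_mul, ih] at key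
    simp only [Complex.ofReal_zero, ne_eq, Nat.succ_ne_zero, not_false_eq_true, zero_pow, zero_mul, neg_zero, zero_div, sub_zero] at key
    rw [sub_eq_zero.1 key, Nat.factorial_succ]
    push_cast
    field_simp
    ring

lemma norm_mul_sub_le {𝕜 : Type*} [RCLike 𝕜] {g f : ℝ → 𝕜} {C : ℝ} {d : ℕ}
    (hg : ∀ x, ‖g x‖ ≤ C * (1 + |x|) ^ d) (x s : ℝ) :
    ‖f s * g (x - s)‖ ≤ C * (1 + |x|) ^ d * (‖f s‖ * (1 + |s|) ^ d) := by
  have hC : 0 ≤ C := by simpa using (norm_nonneg _).trans (hg 0)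
  calc ‖f s * g (x - s)‖ ≤ ‖f s‖ * (C * ((1 + |x|) * (1 + |s|)) ^ d) := by
        rw [norm_mul]
        refine mul_le_mul_of_nonneg_left ((hg _).trans ?_) (norm_nonneg _)
        gcongr
        exact one_add_abs_sub_le x s
    _ = _ := by rw [mul_pow]; ring

lemma integrable_mul_sub {𝕜 : Type*} [RCLike 𝕜] {g f : ℝ → 𝕜} {C : ℝ} {d : ℕ}
    (hgm : Measurable g) (hg : ∀ x, ‖g x‖ ≤ C * (1 + |x|) ^ d)
    (hfm : Measurable f) (hf : Integrable fun s => ‖f s‖ * (1 + |s|) ^ d) (x : ℝ) :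
    Integrable fun s => f s * g (x - s) :=
  (hf.const_mul (C * (1 + |x|) ^ d)).mono' (by fun_prop)
    (Eventually.of_forall fun s => norm_mul_sub_le hg x s)

lemma norm_integral_mul_sub_le {𝕜 : Type*} [RCLike 𝕜] {g f : ℝ → 𝕜} {C : ℝ} {d : ℕ}
    (hg : ∀ x, ‖g x‖ ≤ C * (1 + |x|) ^ d)
    (hf : Integrable fun s => ‖f s‖ * (1 + |s|) ^ d) (x : ℝ) :
    ‖∫ s, f s * g (x - s)‖ ≤ C * (∫ s, ‖f s‖ * (1 + |s|) ^ d) * (1 + |x|) ^ d := by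
  refine (norm_integral_le_of_norm_le (hf.const_mul (C * (1 + |x|) ^ d))
    (Eventually.of_forall fun s => norm_mul_sub_le hg x s)).trans_eq ?_
  rw [integral_const_mul]; ring

lemma tendsto_integral_mul_sub {𝕜 : Type*} [RCLike 𝕜] {g f : ℝ → 𝕜} {C : ℝ} {d : ℕ} {c : 𝕜}
    (hgm : Measurable g) (hg : ∀ x, ‖g x‖ ≤ C * (1 + |x|) ^ d)
    (hlim : Tendsto (fun x : ℝ => (x ^ d)⁻¹ • g x) atTop (𝓝 c))
    (hfm : Measurable f) (hf : Integrable fun s => ‖f s‖ * (1 + |s|) ^ d) :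
    Tendsto (fun x : ℝ => (x ^ d)⁻¹ • ∫ s, f s * g (x - s)) atTop (𝓝 ((∫ s, f s) * c)) := by
  simp_rw [← integral_smul, ← integral_mul_const]
  refine tendsto_integral_filter_of_dominated_convergence
    (fun s => C * 2 ^ d * (‖f s‖ * (1 + |s|) ^ d)) (Eventually.of_forall fun x => by fun_prop) ?_
    (hf.const_mul _) (Eventually.of_forall fun s => ?_)
  · filter_upwards [eventually_ge_atTop 1] with x hx
    refine Eventually.of_forall fun s => ?_
    have hx0 : 0 < x := by linarith
    have hC : 0 ≤ C := by simpa using (norm_nonneg _).trans (hg 0)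
    rw [norm_smul, norm_inv, norm_pow, Real.norm_of_nonneg hx0.le, inv_mul_le_iff₀ (by positivity)]
    refine (norm_mul_sub_le hg x s).trans ?_
    have : (1 + |x|) ^ d ≤ (x * 2) ^ d := by
      gcongr; rw [abs_of_pos hx0]; linarith
    calc _ ≤ C * (x * 2) ^ d * (‖f s‖ * (1 + |s|) ^ d) := by gcongr
      _ = _ := by rw [mul_pow]; ring
  · have h1 : Tendsto (fun x : ℝ => x - s) atTop atTop := tendsto_atTop_add_const_right _ (-s) tendsto_id
    have h2 : Tendsto (fun x : ℝ => (x - s) / x) atTop (𝓝 1) := by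
      have : Tendsto (fun x : ℝ => 1 - s * x⁻¹) atTop (𝓝 (1 - s * 0)) :=
        (tendsto_inv_atTop_zero.const_mul s).const_sub 1
      rw [mul_zero, sub_zero] at this
      refine this.congr' ?_
      filter_upwards [eventually_gt_atTop 0] with x hx
      field_simp
    have h3 := ((h2.pow d).smul (hlim.comp h1)).const_mul (f s)
    rw [one_pow, one_smul] at h3
    refine h3.congr' ?_
    filter_upwards [eventually_gt_atTop 0, eventually_gt_atTop s] with x hx hxs
    have : x - s ≠ 0 := by linarith [sub_pos.2 hxs] |> fun h : 0 < x - s => h.ne'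
    simp only [Function.comp_apply]
    rw [smul_smul, div_pow, mul_smul_comm]
    congr 1
    field_simp

/-- Nonnegative weights `w n` at points `y n ≥ 0` whose Laplace transform is a polar part at `0` of
order at most `d + 1` plus a function that is continuous on the closed right half-plane. -/
structure LaplacePole (w y : ℕ → ℝ) (d : ℕ) (c : ℕ → ℂ) (Φ : ℂ → ℂ) : Prop where
  weight_nonneg : ∀ n, 0 ≤ w n
  point_nonneg : ∀ n, 0 ≤ y n
  summable : ∀ ε : ℝ, 0 < ε → Summable fun n => w n * Real.exp (-(ε * y n))
  tsum_eq : ∀ z : ℂ, 0 < z.re → ∑' n, (w n : ℂ) * Complex.exp (-(z * y n)) =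
    ∑ j ∈ Finset.range (d + 1), c j * (j.factorial / z ^ (j + 1)) + Φ z
  continuousOn : ContinuousOn Φ {z | 0 ≤ z.re}

lemma tsum_mul_fourier {q : ℕ → ℂ} (hq : Summable fun n => ‖q n‖) (y : ℕ → ℝ) {ψ : ℝ → ℂ}
    (hψ : Integrable ψ) (x : ℝ) :
    ∑' n, q n * 𝓕 ψ (x - y n) =
      𝓕 (fun τ => ψ τ * ∑' n, q n * Complex.exp (2 * Real.pi * τ * y n * Complex.I)) x := by
  have hb : ∃ B, ∀ t, ‖𝓕 ψ t‖ ≤ B := by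
    refine ⟨∫ v, ‖ψ v‖, fun t => ?_⟩
    rw [Real.fourier_real_eq_integral_exp_smul]
    refine (norm_integral_le_integral_norm _).trans_eq ?_
    congr 1; ext v
    rw [norm_smul, Complex.norm_exp_ofReal_mul_I, one_mul]
  obtain ⟨B, hB⟩ := hb
  have hqi : Integrable q Measure.count := by rwa [integrable_count_iff]
  have key := integral_mul_fourier hqi (measurable_of_countable y) hψ x
  have e : ∀ f : ℕ → ℂ, Integrable f Measure.count → ∫ n, f n ∂Measure.count = ∑' n, f n := by
    intro f hf
    rw [integral_countable hf]
    simp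
  rw [e _ (hqi.mul_bdd (c := B) (measurable_of_countable _).aestronglyMeasurable (Eventually.of_forall fun n => hB _))] at key
  rw [key]
  refine congrArg (fun f : ℝ → ℂ => 𝓕 f x) (funext fun τ => congrArg (ψ τ * ·) ?_)
  refine e _ (hqi.mul_bdd (c := 1) (by fun_prop) (Eventually.of_forall fun n => ?_))
  rw [Complex.norm_exp]; simp

lemma hasSum_of_tendsto_tsum_mul_exp {b y : ℕ → ℝ} (hb : ∀ n, 0 ≤ b n) (hy : ∀ n, 0 ≤ y n)
    (hs : ∀ ε : ℝ, 0 < ε → Summable fun n => b n * Real.exp (-(ε * y n))) {L : ℂ}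
    (hL : Tendsto (fun ε : ℝ => ((∑' n, b n * Real.exp (-(ε * y n)) : ℝ) : ℂ)) (𝓝[>] 0) (𝓝 L)) :
    Summable b ∧ ((∑' n, b n : ℝ) : ℂ) = L := by
  have hle : ∀ ε : ℝ, 0 < ε → ∀ n, b n * Real.exp (-(ε * y n)) ≤ b n := fun ε hε n =>
    mul_le_of_le_one_right (hb n) (Real.exp_le_one_iff.2 (by have := mul_nonneg hε.le (hy n); linarith))
  have hterm : ∀ n, Tendsto (fun ε : ℝ => b n * Real.exp (-(ε * y n))) (𝓝[>] 0) (𝓝 (b n)) := by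
    intro n
    have : Continuous fun ε : ℝ => b n * Real.exp (-(ε * y n)) := by fun_prop
    simpa using (this.tendsto 0).mono_left nhdsWithin_le_nhds
  have hre : Tendsto (fun ε : ℝ => ∑' n, b n * Real.exp (-(ε * y n))) (𝓝[>] 0) (𝓝 L.re) :=
    (Complex.continuous_re.tendsto L).comp hL
  have hsum : Summable b := by
    refine summable_of_sum_le hb (c := L.re) fun s => ?_
    refine le_of_tendsto_of_tendsto (tendsto_finsetSum s fun n _ => hterm n) hre ?_
    filter_upwards [self_mem_nhdsWithin] with ε hε
    exact (hs ε hε).sum_le_tsum s fun n _ => mul_nonneg (hb n) (Real.exp_nonneg _)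
  refine ⟨hsum, ?_⟩
  have hlim : Tendsto (fun ε : ℝ => ∑' n, b n * Real.exp (-(ε * y n))) (𝓝[>] 0) (𝓝 (∑' n, b n)) := by
    refine tendsto_tsum_of_dominated_convergence hsum hterm ?_
    filter_upwards [self_mem_nhdsWithin] with ε hε n
    rw [Real.norm_of_nonneg (mul_nonneg (hb n) (Real.exp_nonneg _))]
    exact hle ε hε n
  exact tendsto_nhds_unique ((Complex.continuous_ofReal.tendsto _).comp hlim) hL

/-- The density with Laplace transform `∑ j, c j * j! / z ^ (j + 1)`. -/
noncomputable def poleDensity (d : ℕ) (c : ℕ → ℂ) : ℝ → ℂ :=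
  (Set.Ioi 0).indicator fun t => ∑ j ∈ Finset.range (d + 1), c j * (t : ℂ) ^ j

lemma measurable_poleDensity (d : ℕ) (c : ℕ → ℂ) : Measurable (poleDensity d c) :=
  Measurable.indicator (by fun_prop) measurableSet_Ioi

lemma norm_poleDensity_le (d : ℕ) (c : ℕ → ℂ) (t : ℝ) :
    ‖poleDensity d c t‖ ≤ (∑ j ∈ Finset.range (d + 1), ‖c j‖) * (1 + |t|) ^ d := by
  refine (norm_indicator_le_norm_self _ _).trans ((norm_sum_le _ _).trans ?_)
  rw [Finset.sum_mul]
  refine Finset.sum_le_sum fun j hj => ?_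
  rw [norm_mul, norm_pow, Complex.norm_real, Real.norm_eq_abs]
  gcongr
  calc |t| ^ j ≤ (1 + |t|) ^ j := by gcongr; linarith
    _ ≤ (1 + |t|) ^ d := by
      gcongr
      · linarith [abs_nonneg t]
      · exact Nat.lt_succ_iff.1 (Finset.mem_range.1 hj)

lemma tendsto_poleDensity (d : ℕ) (c : ℕ → ℂ) :
    Tendsto (fun x : ℝ => (x ^ d)⁻¹ • poleDensity d c x) atTop (𝓝 (c d)) := by
  have h : Tendsto (fun x : ℝ => ∑ j ∈ Finset.range d, ((x ^ (d - j))⁻¹) • c j + c d) atTop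
      (𝓝 (∑ j ∈ Finset.range d, (0 : ℝ) • c j + c d)) := by
    refine (tendsto_finsetSum _ fun j hj => ?_).add_const _
    refine Tendsto.smul_const ?_ _
    exact (tendsto_pow_atTop (by have := Finset.mem_range.1 hj; omega)).inv_tendsto_atTop
  simp only [zero_smul, Finset.sum_const_zero, zero_add] at h
  refine h.congr' ?_
  filter_upwards [eventually_gt_atTop 0] with x hx
  have hxc : (x : ℂ) ≠ 0 := by exact_mod_cast hx.ne'
  rw [poleDensity, Set.indicator_of_mem (Set.mem_Ioi.2 hx), Finset.sum_range_succ, smul_add, Finset.smul_sum]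
  congr 1
  · refine Finset.sum_congr rfl fun j hj => ?_
    have : x ^ d = x ^ (d - j) * x ^ j := by
      rw [← pow_add]; congr 1; have := Finset.mem_range.1 hj; omega
    rw [this]
    simp only [Complex.real_smul]
    push_cast
    field_simp
  · simp only [Complex.real_smul]
    push_cast
    field_simp

lemma integral_poleDensity_mul_cexp (d : ℕ) (c : ℕ → ℂ) {z : ℂ} (hz : 0 < z.re) :
    Integrable (fun t : ℝ => poleDensity d c t * Complex.exp (-(z * t))) ∧
    ∫ t, poleDensity d c t * Complex.exp (-(z * t)) =
      ∑ j ∈ Finset.range (d + 1), c j * (j.factorial / z ^ (j + 1)) := by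
  have e : (fun t : ℝ => poleDensity d c t * Complex.exp (-(z * t))) =
      (Set.Ioi 0).indicator fun t : ℝ => ∑ j ∈ Finset.range (d + 1), c j * ((t : ℂ) ^ j * Complex.exp (-(z * t))) := by
    ext t
    by_cases ht : t ∈ Set.Ioi (0 : ℝ)
    · simp only [poleDensity, Set.indicator_of_mem ht, Finset.sum_mul, mul_assoc]
    · simp only [poleDensity, Set.indicator_of_notMem ht, zero_mul]
  have hi : ∀ j ∈ Finset.range (d + 1), Integrable (fun t : ℝ => c j * ((t : ℂ) ^ j * Complex.exp (-(z * t))))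
      (volume.restrict (Set.Ioi 0)) := fun j _ => (integrableOn_pow_mul_cexp_neg j hz).const_mul _
  rw [e]
  refine ⟨(integrable_indicator_iff measurableSet_Ioi).2 (integrable_finsetSum _ hi), ?_⟩
  rw [integral_indicator measurableSet_Ioi, integral_finsetSum _ hi]
  simp_rw [integral_const_mul, integral_pow_mul_cexp_neg _ hz]

lemma fourier_add_apply {f g : ℝ → ℂ} (hf : Integrable f) (hg : Integrable g) (x : ℝ) :
    𝓕 (fun τ => f τ + g τ) x = 𝓕 f x + 𝓕 g x := by
  have hi : ∀ {f : ℝ → ℂ}, Integrable f →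
      Integrable fun v : ℝ => Complex.exp (↑(-2 * Real.pi * v * x) * Complex.I) • f v := fun hf =>
    hf.bdd_mul (c := 1) (Continuous.aestronglyMeasurable (by fun_prop))
      (Eventually.of_forall fun v => (Complex.norm_exp_ofReal_mul_I _).le)
  simp_rw [Real.fourier_real_eq_integral_exp_smul, smul_add]
  exact integral_add (hi hf) (hi hg)

section
variable {w y : ℕ → ℝ} {d : ℕ} {c : ℕ → ℂ} {Φ : ℂ → ℂ}

lemma LaplacePole.continuous_boundary (h : LaplacePole w y d c Φ) {ε : ℝ} (hε : 0 ≤ ε) :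
    Continuous fun τ : ℝ => Φ (ε - 2 * Real.pi * τ * Complex.I) :=
  h.continuousOn.comp_continuous (by fun_prop) fun τ => by simpa using hε

lemma LaplacePole.tsum_smoothed (h : LaplacePole w y d c Φ) {ε : ℝ} (hε : 0 < ε) {ψ : ℝ → ℂ}
    (hψ : Continuous ψ) (hψs : HasCompactSupport ψ) (x : ℝ) :
    ∑' n, ((w n * Real.exp (-(ε * y n)) : ℝ) : ℂ) * 𝓕 ψ (x - y n) =
      (∫ t, poleDensity d c t * Complex.exp (-(ε * t)) * 𝓕 ψ (x - t)) +
        𝓕 (fun τ => ψ τ * Φ (ε - 2 * Real.pi * τ * Complex.I)) x := by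
  have hψi : Integrable ψ := hψ.integrable_of_hasCompactSupport hψs
  have hz : ∀ τ : ℝ, 0 < ((ε : ℂ) - 2 * Real.pi * τ * Complex.I).re := fun τ => by simpa using hε
  have hpole := integral_mul_fourier (integral_poleDensity_mul_cexp d c (z := ε) (by simpa using hε)).1
    measurable_id hψi x
  simp only [id] at hpole
  rw [tsum_mul_fourier ?_ _ hψi, hpole, ← fourier_add_apply]
  · refine congrArg (fun f : ℝ → ℂ => 𝓕 f x) (funext fun τ => ?_)
    have h1 := h.tsum_eq _ (hz τ)
    rw [← (integral_poleDensity_mul_cexp d c (hz τ)).2] at h1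
    rw [← mul_add]
    congr 1
    convert! h1 using 3
    · rename_i n
      rw [Complex.ofReal_mul, mul_assoc, Complex.ofReal_exp, ← Complex.exp_add]
      congr 2; push_cast; ring
    · ext t
      rw [mul_assoc, ← Complex.exp_add]
      congr 2; ring
  · have hc : Continuous fun τ : ℝ => ∑ j ∈ Finset.range (d + 1),
        c j * (j.factorial / ((ε : ℂ) - 2 * Real.pi * τ * Complex.I) ^ (j + 1)) := by
      refine continuous_finsetSum _ fun j _ => continuous_const.mul (continuous_const.div (by fun_prop) fun τ => ?_)
      refine pow_ne_zero _ fun h0 => ?_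
      have := hz τ
      rw [h0] at this
      simp at this
    have : (fun τ => ψ τ * ∫ a, poleDensity d c a * Complex.exp (-(ε * a)) *
        Complex.exp (2 * Real.pi * τ * a * Complex.I)) = fun τ => ψ τ * ∑ j ∈ Finset.range (d + 1),
        c j * (j.factorial / ((ε : ℂ) - 2 * Real.pi * τ * Complex.I) ^ (j + 1)) := by
      ext τ
      rw [← (integral_poleDensity_mul_cexp d c (hz τ)).2]
      congr 2; ext t
      rw [mul_assoc, ← Complex.exp_add]
      congr 2; ring
    rw [this]
    exact (hψ.mul hc).integrable_of_hasCompactSupport hψs.mul_right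
  · exact (hψ.mul (h.continuous_boundary hε.le)).integrable_of_hasCompactSupport hψs.mul_right
  · refine (h.summable ε hε).congr fun n => ?_
    rw [Complex.norm_real, Real.norm_of_nonneg (mul_nonneg (h.weight_nonneg n) (Real.exp_nonneg _))]

lemma LaplacePole.tendsto_fourier_boundary (h : LaplacePole w y d c Φ) {ψ : ℝ → ℂ}
    (hψ : Continuous ψ) (hψs : HasCompactSupport ψ) (x : ℝ) :
    Tendsto (fun ε : ℝ => 𝓕 (fun τ => ψ τ * Φ (ε - 2 * Real.pi * τ * Complex.I)) x) (𝓝[>] 0)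
      (𝓝 (𝓕 (fun τ => ψ τ * Φ ((0 : ℝ) - 2 * Real.pi * τ * Complex.I)) x)) := by
  have hcont : ContinuousOn (fun p : ℝ × ℝ => Φ (p.1 - 2 * Real.pi * p.2 * Complex.I))
      (Set.Icc 0 1 ×ˢ tsupport ψ) :=
    h.continuousOn.comp (by fun_prop) fun p hp => by simpa using hp.1.1
  obtain ⟨M, hM⟩ := (isCompact_Icc.prod hψs).exists_bound_of_continuousOn hcont
  simp_rw [Real.fourier_real_eq_integral_exp_smul]
  refine tendsto_integral_filter_of_dominated_convergence (fun τ => ‖ψ τ‖ * M) ?_ ?_ ?_ ?_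
  · filter_upwards [self_mem_nhdsWithin] with ε hε
    have := h.continuous_boundary (le_of_lt hε)
    have he : Continuous fun τ : ℝ => Complex.exp (↑(-2 * Real.pi * τ * x) * Complex.I) := by
      fun_prop
    exact (he.smul (hψ.mul this)).aestronglyMeasurable
  · filter_upwards [Ioc_mem_nhdsGT one_pos] with ε hε
    refine Eventually.of_forall fun τ => ?_
    rw [norm_smul, Complex.norm_exp_ofReal_mul_I, one_mul, norm_mul]
    by_cases hτ : τ ∈ tsupport ψ
    · exact mul_le_mul_of_nonneg_left (hM (ε, τ) ⟨⟨hε.1.le, hε.2⟩, hτ⟩) (norm_nonneg _)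
    · simp [image_eq_zero_of_notMem_tsupport hτ]
  · exact (hψ.integrable_of_hasCompactSupport hψs).norm.mul_const M
  · refine Eventually.of_forall fun τ => Tendsto.const_smul (Tendsto.const_mul _ ?_) _
    have h1 : ContinuousWithinAt Φ {z | 0 ≤ z.re} (((0 : ℝ) : ℂ) - 2 * Real.pi * τ * Complex.I) :=
      h.continuousOn _ (by simp)
    refine h1.tendsto.comp (tendsto_nhdsWithin_iff.2 ⟨?_, ?_⟩)
    · have : Continuous fun ε : ℝ => (ε : ℂ) - 2 * Real.pi * τ * Complex.I := by fun_prop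
      exact (this.tendsto 0).mono_left nhdsWithin_le_nhds
    · filter_upwards [self_mem_nhdsWithin] with ε hε
      simpa using le_of_lt hε

lemma BandLimitedKernel.integrable_norm_mul {φ : ℝ → ℝ} (hφ : BandLimitedKernel φ) (d : ℕ) :
    Integrable fun s => ‖(φ s : ℂ)‖ * (1 + |s|) ^ d := by
  refine (hφ.decay.integrable_mul hφ.continuous d).congr (Eventually.of_forall fun s => ?_)
  simp only [Complex.norm_real, Real.norm_of_nonneg (hφ.nonneg s)]

lemma LaplacePole.tsum_kernel (h : LaplacePole w y d c Φ) {φ : ℝ → ℝ} (hφ : BandLimitedKernel φ) :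
    ∃ χ : ℝ → ℂ, Integrable χ ∧ ∀ x, (Summable fun n => w n * φ (x - y n)) ∧
      ((∑' n, w n * φ (x - y n) : ℝ) : ℂ) = (∫ s, (φ s : ℂ) * poleDensity d c (x - s)) + 𝓕 χ x := by
  obtain ⟨ψ, hψ, hψs, he⟩ := hφ.band
  refine ⟨fun τ => ψ τ * Φ ((0 : ℝ) - 2 * Real.pi * τ * Complex.I),
    (hψ.mul (h.continuous_boundary le_rfl)).integrable_of_hasCompactSupport hψs.mul_right, fun x => ?_⟩
  have hφc := hφ.continuous
  have hkint : Integrable fun t => poleDensity d c t * (φ (x - t) : ℂ) := by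
    have := (integrable_mul_sub (f := fun s => (φ s : ℂ)) (measurable_poleDensity d c) (norm_poleDensity_le d c) (by fun_prop)
      (hφ.integrable_norm_mul d) x).comp_sub_left x
    simpa [mul_comm] using this
  have hbound : ∃ B, ∀ t, φ t ≤ B := by
    obtain ⟨B, hB⟩ := hφ.decay 0
    exact ⟨B, fun t => (le_abs_self _).trans (by simpa using hB t)⟩
  obtain ⟨B, hB⟩ := hbound
  have hlim : Tendsto (fun ε : ℝ => ∫ t, poleDensity d c t * Complex.exp (-(ε * t)) * 𝓕 ψ (x - t)) (𝓝[>] 0)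
      (𝓝 (∫ s, (φ s : ℂ) * poleDensity d c (x - s))) := by
    have : ∫ s, (φ s : ℂ) * poleDensity d c (x - s) = ∫ t, poleDensity d c t * (φ (x - t) : ℂ) := by
      rw [← integral_sub_left_eq_self _ volume x]
      simp [mul_comm]
    rw [this]
    have hm := measurable_poleDensity d c
    simp_rw [he]
    refine tendsto_integral_filter_of_dominated_convergence (fun t => ‖poleDensity d c t * (φ (x - t) : ℂ)‖) ?_ ?_ hkint.norm ?_
    · exact Eventually.of_forall fun ε => by fun_prop
    · filter_upwards [self_mem_nhdsWithin] with ε hε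
      refine Eventually.of_forall fun t => ?_
      rw [norm_mul, norm_mul, norm_mul]
      refine mul_le_mul_of_nonneg_right ?_ (norm_nonneg _)
      by_cases ht : t ∈ Set.Ioi (0 : ℝ)
      · refine mul_le_of_le_one_right (norm_nonneg _) ?_
        rw [Complex.norm_exp]
        simpa using mul_nonneg (le_of_lt hε) (le_of_lt ht)
      · simp [poleDensity, Set.indicator_of_notMem ht]
    · refine Eventually.of_forall fun t => ?_
      have : Continuous fun ε : ℝ => poleDensity d c t * Complex.exp (-(ε * t)) * (φ (x - t) : ℂ) := by fun_prop
      simpa using (this.tendsto 0).mono_left nhdsWithin_le_nhds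
  refine hasSum_of_tendsto_tsum_mul_exp (fun n => mul_nonneg (h.weight_nonneg n) (hφ.nonneg _))
    h.point_nonneg (fun ε hε => ?_) ?_
  · refine ((h.summable ε hε).mul_right B).of_nonneg_of_le
      (fun n => mul_nonneg (mul_nonneg (h.weight_nonneg n) (hφ.nonneg _)) (Real.exp_nonneg _)) fun n => ?_
    rw [mul_right_comm]
    exact mul_le_mul_of_nonneg_left (hB _) (mul_nonneg (h.weight_nonneg n) (Real.exp_nonneg _))
  · refine (hlim.add (h.tendsto_fourier_boundary hψ hψs x)).congr' ?_
    filter_upwards [self_mem_nhdsWithin] with ε hε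
    rw [← h.tsum_smoothed hε hψ hψs x, Complex.ofReal_tsum]
    refine tsum_congr fun n => ?_
    rw [he]; push_cast; ring

/-- The smoothed counting function is `O(|x| ^ d)` and asymptotic to its main term. -/
lemma LaplacePole.tsum_kernel_asymptotics (h : LaplacePole w y d c Φ) {φ : ℝ → ℝ}
    (hφ : BandLimitedKernel φ) {c₀ : ℝ} (hc : c d = c₀) :
    (∃ C, ∀ x, ‖∑' n, w n * φ (x - y n)‖ ≤ C * (1 + |x|) ^ d) ∧
    Tendsto (fun x : ℝ => (x ^ d)⁻¹ • ∑' n, w n * φ (x - y n)) atTop (𝓝 ((∫ s, φ s) * c₀)) := by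
  obtain ⟨χ, hχ, hS⟩ := h.tsum_kernel hφ
  have hφc := hφ.continuous
  constructor
  · refine ⟨(∑ j ∈ Finset.range (d + 1), ‖c j‖) * (∫ s, ‖(φ s : ℂ)‖ * (1 + |s|) ^ d) + ∫ τ, ‖χ τ‖, fun x => ?_⟩
    rw [← Complex.norm_real, (hS x).2, add_mul]
    refine norm_add_le_of_le (norm_integral_mul_sub_le (norm_poleDensity_le d c) (hφ.integrable_norm_mul d) x) ?_
    rw [Real.fourier_real_eq_integral_exp_smul]
    have h1 : ∫ τ, ‖Complex.exp (↑(-2 * Real.pi * τ * x) * Complex.I) • χ τ‖ = ∫ τ, ‖χ τ‖ := by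
      simp_rw [norm_smul, Complex.norm_exp_ofReal_mul_I, one_mul]
    refine (norm_integral_le_integral_norm _).trans (h1.le.trans ?_)
    refine le_mul_of_one_le_right (by positivity) (one_le_pow₀ ?_)
    linarith [abs_nonneg x]
  · have h1 := tendsto_integral_mul_sub (f := fun s => (φ s : ℂ)) (measurable_poleDensity d c) (norm_poleDensity_le d c)
      (tendsto_poleDensity d c) (by fun_prop) (hφ.integrable_norm_mul d)
    have h2 : Tendsto (fun x : ℝ => (x ^ d)⁻¹ • 𝓕 χ x) atTop (𝓝 0) := by
      have hF : Tendsto (𝓕 χ) atTop (𝓝 0) := (Real.zero_at_infty_fourier χ).mono_left atTop_le_cocompact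
      refine squeeze_zero_norm' ?_ (tendsto_zero_iff_norm_tendsto_zero.1 hF)
      filter_upwards [eventually_ge_atTop 1] with x hx
      rw [norm_smul]
      refine mul_le_of_le_one_left (norm_nonneg _) ?_
      rw [norm_inv, norm_pow, Real.norm_of_nonneg (by linarith)]
      exact inv_le_one_of_one_le₀ (one_le_pow₀ hx)
    have h3 := h1.add h2
    rw [add_zero, hc, integral_complex_ofReal, ← Complex.ofReal_mul] at h3
    have h4 := (Complex.continuous_re.tendsto _).comp h3
    rw [Complex.ofReal_re] at h4
    refine h4.congr fun x => ?_
    simp only [Function.comp_apply]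
    rw [← smul_add, ← (hS x).2, Complex.real_smul, ← Complex.ofReal_mul, Complex.ofReal_re, smul_eq_mul]

lemma LaplacePole.measurable_tsum (h : LaplacePole w y d c Φ) {φ : ℝ → ℝ}
    (hφ : BandLimitedKernel φ) : Measurable fun x => ∑' n, w n * φ (x - y n) := by
  obtain ⟨χ, -, hS⟩ := h.tsum_kernel hφ
  have hφc := hφ.continuous
  exact measurable_of_tendsto_metrizable (f := fun N x => ∑ n ∈ Finset.range N, w n * φ (x - y n))
    (fun N => by fun_prop) (tendsto_pi_nhds.2 fun x => (hS x).1.hasSum.tendsto_sum_nat)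

lemma LaplacePole.hasSum_convolution (h : LaplacePole w y d c Φ) {φ K : ℝ → ℝ}
    (hφ : BandLimitedKernel φ) (hc : (c d).im = 0) (hKm : Measurable K)
    (hK : Integrable fun s => ‖K s‖ * (1 + |s|) ^ d) (x : ℝ) :
    HasSum (fun n => w n * ∫ s, K s * φ (x - y n - s))
      (∫ s, K s * ∑' n, w n * φ (x - s - y n)) := by
  obtain ⟨χ, -, hS⟩ := h.tsum_kernel hφ
  obtain ⟨⟨C, hC⟩, -⟩ := h.tsum_kernel_asymptotics hφ (c₀ := (c d).re)
    (Complex.ext (by simp) (by simpa using hc))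
  have hφc := hφ.continuous
  have hnn : ∀ n s, 0 ≤ w n * φ (x - s - y n) := fun n s => mul_nonneg (h.weight_nonneg n) (hφ.nonneg _)
  have hdom := (integrable_mul_sub (f := fun s => ‖K s‖) (h.measurable_tsum hφ) hC (by fun_prop) (by simpa using hK) x)
  have hle : ∀ n s, ‖K s * (w n * φ (x - s - y n))‖ ≤ ‖K s‖ * ∑' n, w n * φ (x - s - y n) := fun n s => by
    rw [norm_mul, Real.norm_of_nonneg (hnn n s)]
    exact mul_le_mul_of_nonneg_left ((hS (x - s)).1.le_tsum n fun m _ => hnn m s) (norm_nonneg _)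
  have hkint : ∀ n, Integrable fun s => K s * (w n * φ (x - s - y n)) := fun n =>
    hdom.mono' (by fun_prop) (Eventually.of_forall (hle n))
  have key := hasSum_integral_of_summable_integral_norm hkint ?_
  · simp_rw [tsum_mul_left] at key
    refine key.congr_fun fun n => ?_
    rw [← integral_const_mul]
    congr 1; ext s
    rw [sub_right_comm]; ring
  · refine summable_of_sum_le (c := ∫ s, ‖K s‖ * ∑' n, w n * φ (x - s - y n))
      (fun n => integral_nonneg fun s => norm_nonneg _) fun t => ?_
    rw [← integral_finsetSum _ fun n _ => (hkint n).norm]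
    refine integral_mono (integrable_finsetSum _ fun n _ => (hkint n).norm) hdom fun s => ?_
    simp only [norm_mul, ← Finset.mul_sum]
    refine mul_le_mul_of_nonneg_left ?_ (norm_nonneg _)
    simp only [← norm_mul, Real.norm_of_nonneg (hnn _ _)]
    exact (hS (x - s)).1.sum_le_tsum t fun n _ => hnn n s

lemma inv_one_add_abs_pow_le (N : ℕ) (x s : ℝ) :
    ((1 + |x - s|) ^ N)⁻¹ ≤ ((1 + |x|) ^ N)⁻¹ * (1 + |s|) ^ N := by
  rw [inv_le_iff_one_le_mul₀ (by positivity), mul_assoc, ← mul_pow, inv_mul_eq_div, one_le_div (by positivity)]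
  have := one_add_abs_sub_le (x - s) (-s)
  rw [sub_neg_eq_add, sub_add_cancel, abs_neg, mul_comm] at this
  gcongr

lemma inv_mul_inv_one_add_abs_pow_le (N : ℕ) (x s : ℝ) :
    ((1 + |x|) ^ N)⁻¹ * ((1 + |s|) ^ N)⁻¹ ≤ ((1 + |x - s|) ^ N)⁻¹ := by
  rw [← mul_inv, ← mul_pow]
  have := one_add_abs_sub_le x s
  gcongr

lemma LaplacePole.tsum_inv_pow_le (h : LaplacePole w y d c Φ) (hc : (c d).im = 0) :
    ∃ C, ∀ x, (Summable fun n => w n * ((1 + |x - y n|) ^ (d + 2))⁻¹) ∧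
      ∑' n, w n * ((1 + |x - y n|) ^ (d + 2))⁻¹ ≤ C * (1 + |x|) ^ d := by
  obtain ⟨φ, hφ, hφ1⟩ := exists_bandLimitedKernel
  obtain ⟨⟨C, hC⟩, -⟩ := h.tsum_kernel_asymptotics hφ (c₀ := (c d).re)
    (Complex.ext (by simp) (by simpa using hc))
  have hφc := hφ.continuous
  let H : ℝ → ℝ := fun s => ((1 + |s|) ^ (d + 2))⁻¹
  have hHpos : ∀ s, 0 < H s := fun s => by positivity
  have hHle : ∀ s, H s ≤ 1 := fun s => inv_le_one_of_one_le₀ (one_le_pow₀ (by linarith [abs_nonneg s]))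
  have hHc : Continuous H := by
    refine Continuous.inv₀ (by fun_prop) fun s => by positivity
  have hHi : Integrable fun s => ‖H s‖ * (1 + |s|) ^ d := by
    refine integrable_inv_one_add_abs_sq.congr (Eventually.of_forall fun s => ?_)
    simp only [Real.norm_of_nonneg (hHpos s).le, H]
    rw [pow_add]; field_simp
  have hφi := hφ.decay.integrable hφc
  have hHφ : Integrable fun s => H s * φ s :=
    hφi.bdd_mul (c := 1) hHc.aestronglyMeasurable
      (Eventually.of_forall fun s => by rw [Real.norm_of_nonneg (hHpos s).le]; exact hHle s)
  set A := ∫ s, H s * φ s with hA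
  have hApos : 0 < A := by
    obtain ⟨t, ht⟩ : ∃ t, φ t ≠ 0 := by
      by_contra! h0
      simp [h0] at hφ1
    exact integral_pos_of_integrable_nonneg_nonzero (x := t) (by fun_prop) hHφ
      (fun s => mul_nonneg (hHpos s).le (hφ.nonneg s)) (mul_ne_zero (hHpos t).ne' ht)
  have hlow : ∀ t, H t ≤ A⁻¹ * ∫ s, H s * φ (t - s) := by
    intro t
    rw [le_inv_mul_iff₀ hApos, ← integral_sub_left_eq_self _ volume t, hA, mul_comm, ← integral_const_mul]
    refine integral_mono (hHφ.const_mul _) ?_ fun s => ?_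
    · simp only [sub_sub_cancel]
      exact hφi.bdd_mul (c := 1) (by fun_prop)
        (Eventually.of_forall fun s => by rw [Real.norm_of_nonneg (hHpos _).le]; exact hHle _)
    · simp only [sub_sub_cancel, ← mul_assoc]
      exact mul_le_mul_of_nonneg_right (inv_mul_inv_one_add_abs_pow_le _ t s) (hφ.nonneg s)
  refine ⟨A⁻¹ * (C * ∫ s, ‖H s‖ * (1 + |s|) ^ d), fun x => ?_⟩
  have hs := (h.hasSum_convolution hφ hc hHc.measurable hHi x).mul_left A⁻¹
  have hle : ∀ n, w n * H (x - y n) ≤ A⁻¹ * (w n * ∫ s, H s * φ (x - y n - s)) := fun n => by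
    rw [mul_left_comm]
    exact mul_le_mul_of_nonneg_left (hlow _) (h.weight_nonneg n)
  have hsum : Summable fun n => w n * H (x - y n) :=
    hs.summable.of_nonneg_of_le (fun n => mul_nonneg (h.weight_nonneg n) (hHpos _).le) hle
  refine ⟨hsum, (hsum.tsum_le_tsum hle hs.summable).trans ?_⟩
  rw [hs.tsum_eq, mul_assoc]
  refine mul_le_mul_of_nonneg_left ((le_abs_self _).trans ?_) (inv_nonneg.2 hApos.le)
  exact norm_integral_mul_sub_le hC hHi x

lemma abs_sub_convolution_le {K K' : ℝ → ℝ} (hK : ∀ t, HasDerivAt K (K' t) t) {N : ℕ} {C : ℝ}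
    (hK' : ∀ t, |K' t| ≤ C * ((1 + |t|) ^ N)⁻¹) {B : ℝ} (hB : ∀ t, |K t| ≤ B)
    {φ : ℝ → ℝ} (hφ : BandLimitedKernel φ) (hφ1 : ∫ t, φ t = 1) {R : ℝ} (hR : 1 ≤ R) (t : ℝ) :
    |K t - ∫ s, K s * (R * φ (R * (t - s)))| ≤
      C * (∫ s, φ s * (1 + |s|) ^ (N + 1)) / R * ((1 + |t|) ^ N)⁻¹ := by
  have hR0 : 0 < R := by linarith
  have hC : 0 ≤ C := by simpa using (abs_nonneg _).trans (hK' 0)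
  have hKc : Continuous K := continuous_iff_continuousAt.2 fun t => (hK t).continuousAt
  have hφc := hφ.continuous
  have hφR := hφ.comp_mul hR
  have hφRi := hφR.decay.integrable hφR.continuous
  have hone : ∫ s, R * φ (R * s) = 1 := by
    rw [integral_const_mul, Measure.integral_comp_mul_left, abs_of_pos (inv_pos.2 hR0), hφ1]
    simp [hR0.ne']
  have hdiff : ∀ s, |K t - K (t - s)| ≤ C * ((1 + |t|) ^ N)⁻¹ * (1 + |s|) ^ N * |s| := by
    intro s
    have := Convex.norm_image_sub_le_of_norm_hasDerivWithin_le (s := Set.uIcc (t - s) t) (f := K) (f' := K')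
      (C := C * ((1 + |t|) ^ N)⁻¹ * (1 + |s|) ^ N) (fun r _ => (hK r).hasDerivWithinAt) ?_
      (convex_uIcc _ _) Set.left_mem_uIcc Set.right_mem_uIcc
    · simpa using this
    · intro r hr
      refine (hK' r).trans ?_
      rw [mul_assoc]
      refine mul_le_mul_of_nonneg_left ?_ hC
      have h1 := inv_one_add_abs_pow_le N t (t - r)
      rw [sub_sub_cancel] at h1
      refine h1.trans ?_
      have : |t - r| ≤ |s| := by
        have := Set.abs_sub_right_of_mem_uIcc hr
        simpa using this
      gcongr
  have hi1 : Integrable fun s => K t * (R * φ (R * s)) := hφRi.const_mul _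
  have hi2 : Integrable fun s => K (t - s) * (R * φ (R * s)) :=
    hφRi.bdd_mul (c := B) (by fun_prop) (Eventually.of_forall fun s => hB _)
  have hrw : K t - ∫ s, K s * (R * φ (R * (t - s))) = ∫ s, (K t - K (t - s)) * (R * φ (R * s)) := by
    simp_rw [sub_mul]
    rw [integral_sub hi1 hi2, integral_const_mul, hone, mul_one, ← integral_sub_left_eq_self _ volume t]
    simp
  have hmom := hφ.decay.integrable_mul hφc (N + 1)
  have hmomR : Integrable fun s => R * (φ (R * s) * (1 + |R * s|) ^ (N + 1)) :=
    (hmom.comp_mul_left' hR0.ne').const_mul R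
  have hmom1 : ∫ s, R * (φ (R * s) * (1 + |R * s|) ^ (N + 1)) = ∫ s, φ s * (1 + |s|) ^ (N + 1) := by
    rw [integral_const_mul, Measure.integral_comp_mul_left (fun u => φ u * (1 + |u|) ^ (N + 1)),
      abs_of_pos (inv_pos.2 hR0), smul_eq_mul, ← mul_assoc, mul_inv_cancel₀ hR0.ne', one_mul]
  rw [hrw, ← Real.norm_eq_abs]
  refine (norm_integral_le_of_norm_le (hmomR.const_mul (C * ((1 + |t|) ^ N)⁻¹ / R))
    (Eventually.of_forall fun s => ?_)).trans_eq ?_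
  · have h0 : 0 ≤ R * φ (R * s) := hφR.nonneg s
    rw [norm_mul, Real.norm_of_nonneg h0, Real.norm_eq_abs]
    refine (mul_le_mul_of_nonneg_right (hdiff s) h0).trans ?_
    have e : |R * s| = R * |s| := by rw [abs_mul, abs_of_pos hR0]
    have h1 : (1 + |s|) ^ N ≤ (1 + |R * s|) ^ N :=
      pow_le_pow_left₀ (by positivity) (by rw [e]; nlinarith [abs_nonneg s]) N
    have h2 : |s| ≤ (1 + |R * s|) / R := by
      rw [le_div_iff₀ hR0, e]; linarith
    have h3 : (1 + |s|) ^ N * |s| ≤ (1 + |R * s|) ^ N * ((1 + |R * s|) / R) := by gcongr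
    calc _ = C * ((1 + |t|) ^ N)⁻¹ * (R * φ (R * s)) * ((1 + |s|) ^ N * |s|) := by ring
      _ ≤ C * ((1 + |t|) ^ N)⁻¹ * (R * φ (R * s)) * ((1 + |R * s|) ^ N * ((1 + |R * s|) / R)) := by gcongr
      _ = _ := by rw [pow_succ]; ring
  · rw [integral_const_mul, hmom1]; ring

theorem LaplacePole.tendsto_tsum (h : LaplacePole w y d c Φ) {c₀ : ℝ} (hc : c d = c₀)
    {K K' : ℝ → ℝ} (hK : ∀ t, HasDerivAt K (K' t) t) (hKd : RapidDecay K) (hK'd : RapidDecay K') :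
    Tendsto (fun x : ℝ => (x ^ d)⁻¹ * ∑' n, w n * K (x - y n)) atTop (𝓝 ((∫ s, K s) * c₀)) := by
  have hKc : Continuous K := continuous_iff_continuousAt.2 fun t => (hK t).continuousAt
  have him : (c d).im = 0 := by simp [hc]
  obtain ⟨C₁, hC₁⟩ := h.tsum_inv_pow_le him
  obtain ⟨C₂, hC₂⟩ := hK'd (d + 2)
  have hC₂' : ∀ t, |K' t| ≤ C₂ * ((1 + |t|) ^ (d + 2))⁻¹ := fun t => by
    rw [← div_eq_mul_inv, le_div_iff₀ (by positivity)]; exact hC₂ t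
  obtain ⟨C₃, hC₃⟩ := hKd (d + 2)
  have hC₃' : ∀ t, |K t| ≤ C₃ * ((1 + |t|) ^ (d + 2))⁻¹ := fun t => by
    rw [← div_eq_mul_inv, le_div_iff₀ (by positivity)]; exact hC₃ t
  obtain ⟨B, hB⟩ := hKd 0
  simp only [pow_zero, mul_one] at hB
  obtain ⟨φ, hφ, hφ1⟩ := exists_bandLimitedKernel
  set M := ∫ s, φ s * (1 + |s|) ^ (d + 2 + 1) with hM
  have hKi : Integrable fun s => ‖K s‖ * (1 + |s|) ^ d := by
    have := (hKd.integrable_mul hKc d).norm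
    refine this.congr (Eventually.of_forall fun s => ?_)
    simp only [norm_mul, norm_pow, Real.norm_of_nonneg (by positivity : 0 ≤ 1 + |s|)]
  have hsumK : ∀ x, Summable fun n => w n * K (x - y n) := fun x => by
    refine ((hC₁ x).1.mul_left C₃).of_norm_bounded fun n => ?_
    rw [norm_mul, Real.norm_of_nonneg (h.weight_nonneg n), mul_left_comm]
    exact mul_le_mul_of_nonneg_left (hC₃' _) (h.weight_nonneg n)
  have herr : ∀ R, 1 ≤ R → ∀ x : ℝ, 1 ≤ x →
      |(x ^ d)⁻¹ * ∑' n, w n * K (x - y n) -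
        (x ^ d)⁻¹ * ∫ s, K s * ∑' n, w n * (R * φ (R * (x - s - y n)))| ≤ C₂ * M * C₁ * 2 ^ d / R := by
    intro R hR x hx
    have hR0 : 0 < R := by linarith
    have hx0 : 0 < x := by linarith
    have hs := h.hasSum_convolution (hφ.comp_mul hR) him hKc.measurable hKi x
    have hE : 0 ≤ C₂ * M / R := by
      have := (abs_nonneg _).trans (abs_sub_convolution_le hK hC₂' hB hφ hφ1 hR 0)
      simpa using this
    rw [← mul_sub, abs_mul, abs_of_pos (by positivity : 0 < (x ^ d)⁻¹), inv_mul_le_iff₀ (by positivity),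
      ← hs.tsum_eq, ← (hsumK x).tsum_sub hs.summable, ← Real.norm_eq_abs]
    refine (tsum_of_norm_bounded ((hC₁ x).1.hasSum.mul_left (C₂ * M / R)) fun n => ?_).trans ?_
    · rw [← mul_sub, norm_mul, Real.norm_of_nonneg (h.weight_nonneg n), mul_left_comm]
      exact mul_le_mul_of_nonneg_left (abs_sub_convolution_le hK hC₂' hB hφ hφ1 hR _) (h.weight_nonneg n)
    · refine (mul_le_mul_of_nonneg_left (hC₁ x).2 hE).trans ?_
      have hC₁0 : 0 ≤ C₁ := by
        have := (hC₁ 0).2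
        simp only [abs_zero, add_zero, one_pow, mul_one] at this
        exact (tsum_nonneg fun n => mul_nonneg (h.weight_nonneg n) (by positivity)).trans this
      have h2 : (1 + |x|) ^ d ≤ (2 * x) ^ d := by
        gcongr; rw [abs_of_pos hx0]; linarith
      calc _ ≤ C₂ * M / R * (C₁ * (2 * x) ^ d) := by gcongr
        _ = _ := by rw [mul_pow]; ring
  rw [Metric.tendsto_atTop]
  intro η hη
  obtain ⟨R, hR, hRη⟩ : ∃ R : ℝ, 1 ≤ R ∧ C₂ * M * C₁ * 2 ^ d / R < η / 2 := by
    have := (tendsto_const_nhds (x := C₂ * M * C₁ * 2 ^ d)).div_atTop tendsto_id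
    obtain ⟨R, h1, h2⟩ := ((eventually_ge_atTop (1 : ℝ)).and (this.eventually (gt_mem_nhds (half_pos hη)))).exists
    exact ⟨R, h1, h2⟩
  have hR0 : 0 < R := by linarith
  have hφR := hφ.comp_mul hR
  obtain ⟨⟨C, hC⟩, hlim⟩ := h.tsum_kernel_asymptotics hφR hc
  have hone : ∫ s, R * φ (R * s) = 1 := by
    rw [integral_const_mul, Measure.integral_comp_mul_left, abs_of_pos (inv_pos.2 hR0), hφ1]
    simp [hR0.ne']
  have hmain := tendsto_integral_mul_sub (h.measurable_tsum hφR) hC hlim hKc.measurable hKi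
  rw [hone, one_mul, Metric.tendsto_atTop] at hmain
  obtain ⟨X, hX⟩ := hmain (η / 2) (half_pos hη)
  refine ⟨max X 1, fun x hx => ?_⟩
  have h1 := hX x ((le_max_left _ _).trans hx)
  have h2 := herr R hR x ((le_max_right _ _).trans hx)
  rw [← Real.dist_eq] at h2
  calc _ ≤ _ := dist_triangle _ _ _
    _ < η / 2 + η / 2 := add_lt_add (h2.trans_lt hRη) h1
    _ = η := add_halves η

end

/-- The integrand of `Γ(a)` in logarithmic coordinates. -/
noncomputable def gammaKernel (a t : ℝ) : ℝ := Real.exp (-(a * t)) * Real.exp (-Real.exp (-t))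

lemma hasDerivAt_gammaKernel (a t : ℝ) :
    HasDerivAt (gammaKernel a) (gammaKernel (a + 1) t - a * gammaKernel a t) t := by
  have h1 : HasDerivAt (fun t => Real.exp (-(a * t))) (Real.exp (-(a * t)) * -(a * 1)) t :=
    ((hasDerivAt_id t).const_mul a).neg.exp
  have h2 : HasDerivAt (fun t => Real.exp (-Real.exp (-t)))
      (Real.exp (-Real.exp (-t)) * -(Real.exp (-t) * -1)) t :=
    (hasDerivAt_id t).neg.exp.neg.exp
  refine (h1.mul h2).congr_deriv ?_
  have : Real.exp (-((a + 1) * t)) = Real.exp (-(a * t)) * Real.exp (-t) := by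
    rw [← Real.exp_add]; ring_nf
  simp only [gammaKernel, this]
  ring

lemma gammaKernel_pos (a t : ℝ) : 0 < gammaKernel a t := by
  unfold gammaKernel; positivity

lemma pow_mul_exp_neg_le {x : ℝ} (hx : 0 ≤ x) (N : ℕ) : x ^ N * Real.exp (-x) ≤ N.factorial := by
  have := Real.pow_div_factorial_le_exp x hx N
  rw [div_le_iff₀ (by positivity)] at this
  rw [Real.exp_neg, ← div_eq_mul_inv, div_le_iff₀ (Real.exp_pos _)]
  linarith

lemma rapidDecay_gammaKernel {a : ℝ} (ha : 0 < a) : RapidDecay (gammaKernel a) := by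
  intro N
  obtain ⟨A, hA⟩ := exists_nat_ge a
  refine ⟨N.factorial / a ^ N * Real.exp a + (A + N).factorial, fun t => ?_⟩
  rw [abs_of_pos (gammaKernel_pos a t)]
  have hp1 : 0 ≤ N.factorial / a ^ N * Real.exp a := by positivity
  have hp2 : (0 : ℝ) ≤ (A + N).factorial := by positivity
  rcases le_total 0 t with ht | ht
  · have h1 := pow_mul_exp_neg_le (x := a * (1 + t)) (by positivity) N
    have h2 : gammaKernel a t ≤ Real.exp (-(a * t)) :=
      mul_le_of_le_one_right (Real.exp_pos _).le (Real.exp_le_one_iff.2 (by simp [Real.exp_nonneg]))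
    have h3 : Real.exp (-(a * t)) = Real.exp (-(a * (1 + t))) * Real.exp a := by
      rw [← Real.exp_add]; ring_nf
    rw [abs_of_nonneg ht]
    calc gammaKernel a t * (1 + t) ^ N ≤ Real.exp (-(a * t)) * (1 + t) ^ N := by gcongr
      _ = (a * (1 + t)) ^ N * Real.exp (-(a * (1 + t))) / a ^ N * Real.exp a := by
        rw [h3, mul_pow]; field_simp
      _ ≤ N.factorial / a ^ N * Real.exp a := by gcongr
      _ ≤ _ := by linarith
  · set v := Real.exp (-t) with hv
    have h1 := pow_mul_exp_neg_le (x := v) (Real.exp_pos _).le (A + N)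
    have h2 : 1 + |t| ≤ v := by
      rw [abs_of_nonpos ht, hv]; linarith [Real.add_one_le_exp (-t)]
    have h3 : Real.exp (-(a * t)) ≤ v ^ A := by
      rw [hv, ← Real.exp_nat_mul]
      exact Real.exp_le_exp.2 (by nlinarith)
    calc gammaKernel a t * (1 + |t|) ^ N ≤ (v ^ A * Real.exp (-v)) * v ^ N := by
          unfold gammaKernel; gcongr
      _ = v ^ (A + N) * Real.exp (-v) := by ring
      _ ≤ (A + N).factorial := h1
      _ ≤ _ := by linarith

lemma RapidDecay.sub_const_mul {f g : ℝ → ℝ} (hf : RapidDecay f) (hg : RapidDecay g) (a : ℝ) :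
    RapidDecay fun t => f t - a * g t := by
  intro N
  obtain ⟨C, hC⟩ := hf N
  obtain ⟨D, hD⟩ := hg N
  refine ⟨C + |a| * D, fun t => ?_⟩
  have h1 := abs_sub (f t) (a * g t)
  rw [abs_mul] at h1
  calc _ ≤ (|f t| + |a| * |g t|) * (1 + |t|) ^ N := by gcongr
    _ = |f t| * (1 + |t|) ^ N + |a| * (|g t| * (1 + |t|) ^ N) := by ring
    _ ≤ _ := add_le_add (hC t) (mul_le_mul_of_nonneg_left (hD t) (abs_nonneg a))

lemma integral_gammaKernel {a : ℝ} (ha : 0 < a) : ∫ t, gammaKernel a t = Real.Gamma a := by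
  have himg : (fun t : ℝ => Real.exp (-t)) '' Set.univ = Set.Ioi 0 := by
    rw [Set.image_univ, ← Real.range_exp]
    exact (Equiv.neg ℝ).surjective.range_comp Real.exp
  have := integral_image_eq_integral_abs_deriv_smul (s := Set.univ)
    (f := fun t : ℝ => Real.exp (-t)) (f' := fun t => Real.exp (-t) * -1) MeasurableSet.univ
    (fun t _ => ((hasDerivAt_id t).neg.exp).hasDerivWithinAt)
    (fun x _ y _ h => by simpa using h) (fun v => Real.exp (-v) * v ^ (a - 1))
  rw [Real.Gamma_eq_integral ha, ← himg, this, setIntegral_univ]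
  congr 1; ext t
  rw [mul_neg_one, abs_neg, abs_of_pos (Real.exp_pos _), smul_eq_mul, ← Real.exp_mul, gammaKernel,
    show -(a * t) = -t + -t * (a - 1) by ring, Real.exp_add]
  ring

/-- The normalised subgroup counts `a_{n+1}(G) (n+1)^{-α}`. -/
noncomputable def subgroupWeight (G : Type*) [Group G] (α : ℝ) (n : ℕ) : ℝ :=
  (aCount G (n + 1) : ℝ) * ((n : ℝ) + 1) ^ (-α)

lemma subgroupWeight_mul_cexp (G : Type*) [Group G] (α : ℝ) (n : ℕ) (z : ℂ) :
    (subgroupWeight G α n : ℂ) * Complex.exp (-(z * Real.log ((n : ℝ) + 1))) =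
      (aCount G (n + 1) : ℂ) * ((n + 1 : ℕ) : ℂ) ^ (-((α : ℂ) + z)) := by
  have hn : (0 : ℝ) < (n : ℝ) + 1 := by positivity
  have hn' : ((n + 1 : ℕ) : ℂ) ≠ 0 := by exact_mod_cast n.succ_ne_zero
  have h1 : (((n : ℝ) + 1 : ℝ) : ℂ) = ((n + 1 : ℕ) : ℂ) := by push_cast; rfl
  rw [subgroupWeight, Complex.ofReal_mul, Complex.ofReal_cpow hn.le, Complex.ofReal_log hn.le, h1,
    neg_add, Complex.cpow_add _ _ hn', Complex.cpow_def_of_ne_zero hn' (-z), Complex.ofReal_natCast,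
    Complex.ofReal_neg, mul_assoc]
  congr 3; ring

lemma laplacePole_subgroupWeight (G : Type*) [Group G] (α : ℝ) (m : ℕ) (hm : 1 ≤ m) (γ : ℝ)
    (ν : ℕ → ℂ) (Φ : ℂ → ℂ) (hΦc : ContinuousOn Φ {s : ℂ | α ≤ s.re})
    (hsum : ∀ s : ℂ, α < s.re →
      Summable fun δ : ℕ => ‖(aCount G (δ + 1) : ℂ) * ((δ + 1 : ℕ) : ℂ) ^ (-s)‖)
    (hval : ∀ s : ℂ, α < s.re →
      ∑' δ : ℕ, (aCount G (δ + 1) : ℂ) * ((δ + 1 : ℕ) : ℂ) ^ (-s) =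
        (γ : ℂ) / (s - (α : ℂ)) ^ m
          + (∑ j ∈ Finset.Icc 1 (m - 1), ν j / (s - (α : ℂ)) ^ j) + Φ s) :
    LaplacePole (subgroupWeight G α) (fun n => Real.log ((n : ℝ) + 1)) (m - 1)
      (fun j => if j = m - 1 then ((γ / (m - 1).factorial : ℝ) : ℂ) else ν (j + 1) / j.factorial)
      (fun z => Φ (α + z)) where
  weight_nonneg n := by unfold subgroupWeight; positivity
  point_nonneg n := Real.log_nonneg (by simp)
  summable ε hε := by
    refine (hsum (α + ε) (by simpa using hε)).congr fun n => ?_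
    rw [← subgroupWeight_mul_cexp, norm_mul, Complex.norm_real, Complex.norm_exp,
      Real.norm_of_nonneg (by unfold subgroupWeight; positivity)]
    congr 2
    simp [← Complex.ofReal_mul]
  tsum_eq z hz := by
    obtain ⟨d, rfl⟩ : ∃ d, m = d + 1 := ⟨m - 1, by omega⟩
    simp_rw [subgroupWeight_mul_cexp]
    rw [hval _ (by simpa using hz), add_sub_cancel_left, Nat.add_sub_cancel, Finset.sum_range_succ,
      add_comm (_ / _)]
    congr 2
    · rw [← Finset.Ico_add_one_right_eq_Icc, Finset.sum_Ico_eq_sum_range, Nat.add_sub_cancel]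
      refine Finset.sum_congr rfl fun j hj => ?_
      have : (j.factorial : ℂ) ≠ 0 := by exact_mod_cast j.factorial_ne_zero
      rw [if_neg (Finset.mem_range.1 hj).ne, add_comm 1 j]
      field_simp
    · have : (d.factorial : ℂ) ≠ 0 := by exact_mod_cast d.factorial_ne_zero
      simp only [if_true]
      push_cast
      field_simp
  continuousOn := by
    refine hΦc.comp (by fun_prop) fun z hz => ?_
    simpa using hz

lemma Wfun_eq_tsum_gammaKernel (G : Type*) [Group G] (α β : ℝ) {u : ℝ} (hu : 0 < u) :
    Wfun G β u = u ^ (-(α + β)) *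
      ∑' n : ℕ, subgroupWeight G α n * gammaKernel (α + β) (-Real.log u - Real.log ((n : ℝ) + 1)) := by
  rw [Wfun, ← tsum_mul_left]
  congr 1; ext n
  have hn : (0 : ℝ) < (n : ℝ) + 1 := by positivity
  have h1 : -(-Real.log u - Real.log ((n : ℝ) + 1)) = Real.log (u * (n + 1)) := by
    rw [Real.log_mul hu.ne' hn.ne']; ring
  have h2 : -((α + β) * (-Real.log u - Real.log ((n : ℝ) + 1))) =
      Real.log (u * (n + 1)) * (α + β) := by rw [← h1]; ring
  rw [gammaKernel, h2, h1, Real.exp_log (by positivity), ← Real.rpow_def_of_pos (by positivity),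
    Real.mul_rpow hu.le hn.le, subgroupWeight, Real.rpow_neg hu.le, Real.rpow_neg hn.le,
    Real.rpow_add hn]
  have : ((n : ℝ) + 1) ^ α ≠ 0 := by positivity
  have : u ^ (α + β) ≠ 0 := by positivity
  rw [show -((n : ℝ) + 1) * u = -(u * (n + 1)) by ring]
  field_simp

end

theorem W_asymptotics
    (G : Type*) [Group G] [Group.FG G]
    (α : ℝ) (hα : 0 < α) (m : ℕ) (hm : 1 ≤ m) (γ : ℝ) (hγ : 0 < γ)
    (ν : ℕ → ℂ) (Φ : ℂ → ℂ)
    (hΦc : ContinuousOn Φ {s : ℂ | α ≤ s.re})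
    (hΦd : DifferentiableOn ℂ Φ {s : ℂ | α < s.re})
    (hsum : ∀ s : ℂ, α < s.re →
      Summable fun δ : ℕ => ‖(aCount G (δ + 1) : ℂ) * ((δ + 1 : ℕ) : ℂ) ^ (-s)‖)
    (hval : ∀ s : ℂ, α < s.re →
      ∑' δ : ℕ, (aCount G (δ + 1) : ℂ) * ((δ + 1 : ℕ) : ℂ) ^ (-s) =
        (γ : ℂ) / (s - (α : ℂ)) ^ m
          + (∑ j ∈ Finset.Icc 1 (m - 1), ν j / (s - (α : ℂ)) ^ j) + Φ s)
    (β : ℝ) (hβ : -α < β) :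
    Asymptotics.IsEquivalent (nhdsWithin 0 (Set.Ioi 0))
      (fun u : ℝ => Wfun G β u)
      (fun u : ℝ =>
        (Real.Gamma (α + β) * γ / (Nat.factorial (m - 1) : ℝ)) *
          u ^ (-(α + β)) * (-Real.log u) ^ (m - 1)) := by

  have ha : 0 < α + β := by linarith
  have h := (laplacePole_subgroupWeight G α m hm γ ν Φ hΦc hsum hval).tendsto_tsum
    (c₀ := γ / (m - 1).factorial) (if_pos rfl) (hasDerivAt_gammaKernel (α + β))
    (rapidDecay_gammaKernel ha)
    ((rapidDecay_gammaKernel (by linarith)).sub_const_mul (rapidDecay_gammaKernel ha) (α + β))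
  rw [integral_gammaKernel ha] at h
  have hL : 0 < Real.Gamma (α + β) * (γ / (m - 1).factorial) :=
    mul_pos (Real.Gamma_pos_of_pos ha) (by positivity)
  have hlog : Filter.Tendsto (fun u => -Real.log u) (nhdsWithin 0 (Set.Ioi 0)) Filter.atTop :=
    Filter.tendsto_neg_atBot_atTop.comp Real.tendsto_log_nhdsGT_zero
  refine Asymptotics.isEquivalent_of_tendsto_one ?_
  have h2 := (h.comp hlog).div_const (Real.Gamma (α + β) * (γ / (m - 1).factorial))
  rw [div_self hL.ne'] at h2
  refine h2.congr' ?_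
  filter_upwards [self_mem_nhdsWithin] with u hu
  have hu0 : (0 : ℝ) < u := hu
  have : u ^ (-(α + β)) ≠ 0 := by positivity
  simp only [Function.comp_apply, Pi.div_apply]
  rw [Wfun_eq_tsum_gammaKernel G α β hu0, mul_div_assoc (Real.Gamma (α + β)),
    mul_right_comm _ (u ^ (-(α + β))), mul_comm _ (u ^ (-(α + β))), mul_div_mul_left _ _ this,
    inv_mul_eq_div, div_div, mul_comm ((-Real.log u) ^ (m - 1))]
end

section
/- Let G be a finitely generated group and assume hypothesis (★) holds. Then for every real β > −α, as the integer N → ∞ one has the asymptotic equivalence ∑_{δ=1}^{N} δ^β a_δ(G) ∼ (γ/((m−1)!·(α+β))) · N^{α+β} · (ln N)^{m−1}, i.e. the ratio of the two sides tends to 1. -/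
open scoped BigOperators

open FourierTransform MeasureTheory Filter Topology

theorem exists_fourier_nonneg :
    ∃ (w : ℝ → ℂ) (K : ℝ → ℝ), Continuous w ∧ HasCompactSupport w ∧ (∀ v, 𝓕 w v = K v) ∧
      Continuous K ∧ (∀ v, 0 ≤ K v) ∧ Integrable K ∧ 0 < ∫ v, K v := by
  let ψ : ContDiffBump (0 : ℝ) := default
  let f : ℝ → ℂ := fun x => (ψ x : ℂ)
  have hfc : ContDiff ℝ (⊤ : ℕ∞) f := Complex.ofRealCLM.contDiff.comp ψ.contDiff
  have hfs : HasCompactSupport f := ψ.hasCompactSupport.comp_left (g := fun x : ℝ => (x : ℂ)) rfl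
  have hfi : Integrable f := hfc.continuous.integrable_of_hasCompactSupport hfs
  let g : SchwartzMap ℝ ℂ := 𝓕 (hfs.toSchwartzMap hfc)
  have hg : ∀ v, g v = 𝓕 f v := fun v => by
    simp only [g, SchwartzMap.fourier_coe]; rfl
  have hreal : ∀ v, ((g v).re : ℂ) = g v := by
    intro v
    rw [← Complex.conj_eq_iff_re, hg, Real.fourier_real_eq_integral_exp_smul,
      ← integral_conj, ← integral_neg_eq_self]
    congr 1
    ext x
    simp only [f, smul_eq_mul, map_mul, ← Complex.exp_conj, Complex.conj_ofReal, ψ.neg, Complex.conj_I]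
    congr 2
    push_cast
    ring
  refine ⟨MeasureTheory.convolution f f (ContinuousLinearMap.mul ℂ ℂ) volume,
    fun v => (g v).re ^ 2, ?_, ?_, ?_, ?_, fun v => sq_nonneg _, ?_, ?_⟩
  · exact hfs.continuous_convolution_right _ hfi.locallyIntegrable hfc.continuous
  · exact hfs.convolution _ hfs
  · intro v
    rw [Real.fourier_mul_convolution_eq hfi hfi, ← hg]
    push_cast
    rw [hreal, sq]
  · exact (Complex.continuous_re.comp g.continuous).pow 2
  · exact (g.memLp 2).re.integrable_sq
  · refine integral_pos_of_integrable_nonneg_nonzero (x := 0)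
      ((Complex.continuous_re.comp g.continuous).pow 2) (g.memLp 2).re.integrable_sq
      (fun v => sq_nonneg _) ?_
    have h0 : g 0 = ((∫ x, ψ x : ℝ) : ℂ) := by
      rw [hg, Real.fourier_real_eq_integral_exp_smul, ← integral_complex_ofReal]
      simp [f]
    rw [h0]
    have hpos := (ψ.integral_pos (μ := volume)).ne'
    exact pow_ne_zero _ (by simpa using hpos)

/-- Probability kernels with compactly supported Fourier transform concentrate near `0`. -/
theorem exists_concentrated_kernel {η θ : ℝ} (hη : 0 < η) (hθ : 0 < θ) :
    ∃ (w : ℝ → ℂ) (K : ℝ → ℝ), Continuous w ∧ HasCompactSupport w ∧ (∀ v, 𝓕 w v = K v) ∧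
      Continuous K ∧ (∀ v, 0 ≤ K v) ∧ Integrable K ∧ ∫ v, K v = 1 ∧
      1 - θ ≤ ∫ v in Set.Ioc (-η) η, K v := by
  obtain ⟨w, K, hw, hws, hwK, hK, hK0, hKi, hI⟩ := exists_fourier_nonneg
  set I := ∫ v, K v with hIdef
  have hlim : Tendsto (fun l : ℝ => (∫ v in (-(l * η))..(l * η), K v) / I) atTop (𝓝 1) := by
    have h1 : Tendsto (fun l : ℝ => l * η) atTop atTop := tendsto_id.atTop_mul_const hη
    have := (intervalIntegral_tendsto_integral hKi
      (tendsto_neg_atTop_atBot.comp h1) h1).div_const I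
    rwa [← hIdef, div_self hI.ne'] at this
  obtain ⟨l, hl, hl0⟩ := ((hlim.eventually (lt_mem_nhds (show 1 - θ < 1 by linarith))).and
    (eventually_gt_atTop (0 : ℝ))).exists
  refine ⟨fun ξ => w (l⁻¹ * ξ) / I, fun v => l / I * K (l * v), by fun_prop, ?_, ?_, by fun_prop,
    fun v => mul_nonneg (by positivity) (hK0 _), ?_, ?_, ?_⟩
  · have := (hws.comp_homeomorph (Homeomorph.mulLeft₀ l⁻¹ (inv_ne_zero hl0.ne')))
    exact this.comp_left (g := fun z : ℂ => z / I) (by simp)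
  · intro v
    push_cast
    rw [← hwK, Real.fourier_real_eq_integral_exp_smul, Real.fourier_real_eq_integral_exp_smul]
    have := Measure.integral_comp_mul_left
      (fun ξ : ℝ => Complex.exp (↑(-2 * Real.pi * ξ * (l * v)) * Complex.I) • w ξ) l⁻¹
    rw [inv_inv, abs_of_pos hl0] at this
    rw [div_mul_eq_mul_div, ← Complex.real_smul, ← this, ← integral_div]
    congr 1
    ext ξ
    rw [smul_eq_mul, smul_eq_mul, mul_div_assoc]
    congr 4
    field_simp
  · exact (hKi.comp_mul_left' hl0.ne').const_mul _
  · rw [integral_const_mul, Measure.integral_comp_mul_left, abs_of_pos (inv_pos.2 hl0), smul_eq_mul,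
      ← hIdef]
    field_simp
  · rw [← intervalIntegral.integral_of_le (by linarith), intervalIntegral.integral_const_mul,
      intervalIntegral.integral_comp_mul_left _ hl0.ne', smul_eq_mul, mul_neg]
    refine hl.le.trans (le_of_eq ?_)
    field_simp

theorem norm_cexp_neg_mul_ofReal (z : ℂ) (y : ℝ) :
    ‖Complex.exp (-z * y)‖ = Real.exp (-z.re * y) := by
  simp [Complex.norm_exp]

theorem integrableOn_pow_mul_exp_neg_mul (k : ℕ) {ε : ℝ} (hε : 0 < ε) :
    IntegrableOn (fun y : ℝ => y ^ k * Real.exp (-ε * y)) (Set.Ioi 0) := by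
  have := integrableOn_rpow_mul_exp_neg_mul_rpow (s := k) (p := 1) (b := ε)
    (by linarith [(Nat.cast_nonneg k : (0 : ℝ) ≤ k)]) one_pos hε
  simpa using this

theorem integrableOn_pow_mul_cexp_neg_mul (k : ℕ) {z : ℂ} (hz : 0 < z.re) :
    IntegrableOn (fun y : ℝ => (y : ℂ) ^ k * Complex.exp (-z * y)) (Set.Ioi 0) := by
  refine (integrableOn_pow_mul_exp_neg_mul k hz).mono' (by fun_prop) ?_
  filter_upwards [self_mem_ae_restrict measurableSet_Ioi] with y hy
  rw [norm_mul, norm_cexp_neg_mul_ofReal, norm_pow, Complex.norm_real, Real.norm_eq_abs,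
    abs_of_pos hy]

theorem integral_pow_mul_cexp_neg_mul (k : ℕ) {z : ℂ} (hz : 0 < z.re) :
    ∫ y in Set.Ioi (0 : ℝ), (y : ℂ) ^ k * Complex.exp (-z * y) = k.factorial / z ^ (k + 1) := by
  have hz0 : z ≠ 0 := by rintro rfl; simp at hz
  induction k with
  | zero =>
    have := integral_exp_mul_complex_Ioi (a := -z) (by simpa using hz) 0
    simp only [pow_zero, one_mul, this]
    simp
  | succ k ih =>
    have hd : ∀ y ∈ Set.Ici (0 : ℝ), HasDerivAt
        (fun y : ℝ => (y : ℂ) ^ (k + 1) * Complex.exp (-z * y))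
        ((k + 1) * ((y : ℂ) ^ k * Complex.exp (-z * y))
          - z * ((y : ℂ) ^ (k + 1) * Complex.exp (-z * y))) y := by
      intro y _
      have h1 : HasDerivAt (fun y : ℝ => (y : ℂ)) 1 y := Complex.ofRealCLM.hasDerivAt
      have h2 := (h1.fun_pow (k + 1)).mul (h1.const_mul (-z)).cexp
      refine h2.congr_deriv ?_
      push_cast
      ring_nf
    have hi1 := (integrableOn_pow_mul_cexp_neg_mul k hz).const_mul ((k : ℂ) + 1)
    have hi2 := (integrableOn_pow_mul_cexp_neg_mul (k + 1) hz).const_mul z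
    have hlim : Tendsto (fun y : ℝ => (y : ℂ) ^ (k + 1) * Complex.exp (-z * y)) atTop (𝓝 0) := by
      rw [tendsto_zero_iff_norm_tendsto_zero]
      refine (tendsto_rpow_mul_exp_neg_mul_atTop_nhds_zero (k + 1) z.re hz).congr' ?_
      filter_upwards [eventually_gt_atTop 0] with y hy
      rw [norm_mul, norm_cexp_neg_mul_ofReal, norm_pow, Complex.norm_real, Real.norm_eq_abs,
        abs_of_pos hy, ← Real.rpow_natCast]
      push_cast
      rfl
    have := integral_Ioi_of_hasDerivAt_of_tendsto' hd (hi1.sub hi2) hlim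
    rw [integral_sub hi1 hi2, integral_const_mul, integral_const_mul, ih] at this
    simp only [Complex.ofReal_zero, ne_eq, Nat.add_eq_zero_iff, one_ne_zero, and_false,
      not_false_eq_true, zero_pow, zero_mul, sub_zero, sub_eq_zero] at this
    rw [← mul_right_inj' hz0, ← this, Nat.factorial_succ]
    push_cast
    field_simp
    ring

/-- Smoothing a function against a kernel is integrating its Laplace transform along a vertical
line against the Fourier transform of the kernel. -/
theorem integral_mul_fourier_sub_eq {D w : ℝ → ℂ} {ε : ℝ}
    (hD : Integrable fun y : ℝ => D y * Complex.exp (-(ε : ℂ) * y)) (hw : Continuous w)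
    (hws : HasCompactSupport w) (x : ℝ) :
    ∫ y, D y * Complex.exp (-(ε : ℂ) * y) * 𝓕 w (y - x) =
      ∫ ξ : ℝ, (∫ y, D y * Complex.exp (-((ε : ℂ) + 2 * Real.pi * ξ * Complex.I) * y)) *
        (Complex.exp (2 * Real.pi * ξ * x * Complex.I) * w ξ) := by
  have hg : Integrable fun ξ : ℝ => Complex.exp (2 * Real.pi * ξ * x * Complex.I) * w ξ :=
    (by fun_prop : Continuous _).integrable_of_hasCompactSupport hws.mul_left
  have key := VectorFourier.integral_fourierIntegral_smul_eq_flip (L := innerₗ ℝ) (μ := volume)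
    (ν := volume) Real.continuous_fourierChar continuous_inner hD hg
  rw [flip_innerₗ] at key
  have e1 : ∀ ξ, VectorFourier.fourierIntegral 𝐞 volume (innerₗ ℝ)
      (fun y : ℝ => D y * Complex.exp (-(ε : ℂ) * y)) ξ =
      ∫ y, D y * Complex.exp (-((ε : ℂ) + 2 * Real.pi * ξ * Complex.I) * y) := by
    intro ξ
    change 𝓕 (fun y : ℝ => D y * Complex.exp (-(ε : ℂ) * y)) ξ = _
    rw [Real.fourier_real_eq_integral_exp_smul]
    congr 1
    ext y
    rw [smul_eq_mul, mul_left_comm, ← Complex.exp_add]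
    congr 2
    push_cast
    ring
  have e2 : ∀ y, VectorFourier.fourierIntegral 𝐞 volume (innerₗ ℝ)
      (fun ξ : ℝ => Complex.exp (2 * Real.pi * ξ * x * Complex.I) * w ξ) y = 𝓕 w (y - x) := by
    intro y
    change 𝓕 (fun ξ : ℝ => Complex.exp (2 * Real.pi * ξ * x * Complex.I) * w ξ) y = _
    rw [Real.fourier_real_eq_integral_exp_smul, Real.fourier_real_eq_integral_exp_smul]
    congr 1
    ext ξ
    rw [smul_eq_mul, smul_eq_mul, ← mul_assoc, ← Complex.exp_add]
    congr 2
    push_cast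
    ring
  simp only [e1, e2, smul_eq_mul] at key
  exact key.symm

theorem norm_cexp_two_pi_mul (ξ x : ℝ) :
    ‖Complex.exp (2 * Real.pi * ξ * x * Complex.I)‖ = 1 := by
  rw [← Complex.norm_exp_ofReal_mul_I (2 * Real.pi * ξ * x)]
  push_cast
  rfl

theorem exists_bound_vertical {h : ℂ → ℂ} (hh : ContinuousOn h {z : ℂ | 0 ≤ z.re})
    {w : ℝ → ℂ} (hws : HasCompactSupport w) :
    ∃ M : ℝ, 0 ≤ M ∧ ∀ ε : ℝ, 0 ≤ ε → ε ≤ 1 → ∀ ξ : ℝ,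
      ‖h (ε + 2 * Real.pi * ξ * Complex.I) * w ξ‖ ≤ M * ‖w ξ‖ := by
  have hc : IsCompact ((fun q : ℝ × ℝ => (q.1 : ℂ) + 2 * Real.pi * q.2 * Complex.I) ''
      (Set.Icc (0 : ℝ) 1 ×ˢ tsupport w)) :=
    (isCompact_Icc.prod hws).image (by fun_prop)
  obtain ⟨M, hM⟩ := hc.exists_bound_of_continuousOn (f := h) (hh.mono (by
    rintro _ ⟨q, hq, rfl⟩
    simpa using hq.1.1))
  refine ⟨max M 0, le_max_right _ _, fun ε h0 h1 ξ => ?_⟩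
  rw [norm_mul]
  by_cases hξ : ξ ∈ tsupport w
  · gcongr
    exact (hM _ ⟨(ε, ξ), ⟨⟨h0, h1⟩, hξ⟩, rfl⟩).trans (le_max_left _ _)
  · simp [image_eq_zero_of_notMem_tsupport hξ]

theorem tendsto_vertical {h : ℂ → ℂ} (hh : ContinuousOn h {z : ℂ | 0 ≤ z.re}) (ξ : ℝ) :
    Tendsto (fun x : ℝ => h ((x⁻¹ : ℝ) + 2 * Real.pi * ξ * Complex.I)) atTop
      (𝓝 (h (2 * Real.pi * ξ * Complex.I))) := by
  refine (hh (2 * Real.pi * ξ * Complex.I) (by simp)).tendsto.comp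
    (tendsto_nhdsWithin_iff.2 ⟨?_, ?_⟩)
  · have : Tendsto (fun x : ℝ => ((x⁻¹ : ℝ) : ℂ)) atTop (𝓝 ((0 : ℝ) : ℂ)) :=
      (Complex.continuous_ofReal.tendsto 0).comp tendsto_inv_atTop_zero
    simpa using this.add_const (2 * Real.pi * ξ * Complex.I)
  · filter_upwards [eventually_gt_atTop 0] with x hx
    simpa using hx.le

theorem continuous_vertical {h : ℂ → ℂ} (hh : ContinuousOn h {z : ℂ | 0 ≤ z.re}) {ε : ℝ}
    (hε : 0 ≤ ε) : Continuous fun ξ : ℝ => h (ε + 2 * Real.pi * ξ * Complex.I) :=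
  hh.comp_continuous (by fun_prop) fun ξ => by simpa using hε

/-- A uniform version of the Riemann-Lebesgue lemma along vertical lines tending to the imaginary
axis. -/
theorem tendsto_vertical_integral_zero {h : ℂ → ℂ} (hh : ContinuousOn h {z : ℂ | 0 ≤ z.re})
    {w : ℝ → ℂ} (hw : Continuous w) (hws : HasCompactSupport w) :
    Tendsto (fun x : ℝ => ∫ ξ : ℝ, h ((x⁻¹ : ℝ) + 2 * Real.pi * ξ * Complex.I) *
        (Complex.exp (2 * Real.pi * ξ * x * Complex.I) * w ξ)) atTop (𝓝 0) := by
  obtain ⟨M, hM0, hM⟩ := exists_bound_vertical hh hws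
  have hwi : Integrable w := hw.integrable_of_hasCompactSupport hws
  have hmaj : ∀ x : ℝ, 1 ≤ x → ∀ ξ : ℝ, ‖h ((x⁻¹ : ℝ) + 2 * Real.pi * ξ * Complex.I) *
      (Complex.exp (2 * Real.pi * ξ * x * Complex.I) * w ξ)‖ ≤ M * ‖w ξ‖ := by
    intro x hx ξ
    have := hM x⁻¹ (by positivity) (inv_le_one_of_one_le₀ hx) ξ
    rwa [norm_mul, norm_mul, norm_cexp_two_pi_mul, one_mul, ← norm_mul]
  have hmaj0 : ∀ x ξ : ℝ, ‖h (2 * Real.pi * ξ * Complex.I) *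
      (Complex.exp (2 * Real.pi * ξ * x * Complex.I) * w ξ)‖ ≤ M * ‖w ξ‖ := by
    intro x ξ
    have := hM 0 le_rfl zero_le_one ξ
    rw [Complex.ofReal_zero, zero_add] at this
    rwa [norm_mul, norm_mul, norm_cexp_two_pi_mul, one_mul, ← norm_mul]
  have hc0 := continuous_vertical hh le_rfl
  simp only [Complex.ofReal_zero, zero_add] at hc0
  have h1 : Tendsto (fun x : ℝ => ∫ ξ : ℝ,
      (h ((x⁻¹ : ℝ) + 2 * Real.pi * ξ * Complex.I) - h (2 * Real.pi * ξ * Complex.I)) *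
        (Complex.exp (2 * Real.pi * ξ * x * Complex.I) * w ξ)) atTop (𝓝 (∫ _ : ℝ, (0 : ℂ))) := by
    refine tendsto_integral_filter_of_dominated_convergence (fun ξ => M * ‖w ξ‖ + M * ‖w ξ‖)
      ?_ ?_ ((hwi.norm.const_mul M).add (hwi.norm.const_mul M)) (ae_of_all _ fun ξ => ?_)
    · filter_upwards [eventually_ge_atTop 1] with x hx
      have hcx := continuous_vertical hh (inv_nonneg.2 (zero_le_one.trans hx))
      exact ((hcx.sub hc0).mul (by fun_prop)).aestronglyMeasurable
    · filter_upwards [eventually_ge_atTop 1] with x hx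
      refine ae_of_all _ fun ξ => ?_
      rw [sub_mul]
      exact (norm_sub_le _ _).trans (add_le_add (hmaj x hx ξ) (hmaj0 x ξ))
    · have h2 := ((tendsto_vertical hh ξ).sub_const (h (2 * Real.pi * ξ * Complex.I))).norm.mul_const
        ‖w ξ‖
      rw [sub_self, norm_zero, zero_mul] at h2
      rw [tendsto_zero_iff_norm_tendsto_zero]
      refine h2.congr fun x => ?_
      rw [norm_mul, norm_mul, norm_cexp_two_pi_mul, one_mul]
  have h2 : Tendsto (fun x : ℝ => ∫ ξ : ℝ, h (2 * Real.pi * ξ * Complex.I) *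
      (Complex.exp (2 * Real.pi * ξ * x * Complex.I) * w ξ)) atTop (𝓝 0) := by
    have := (Real.zero_at_infty_fourier
      (fun ξ : ℝ => h (2 * Real.pi * ξ * Complex.I) * w ξ)).comp
      (tendsto_neg_atTop_atBot.mono_right atBot_le_cocompact)
    refine this.congr fun x => ?_
    rw [Function.comp_apply, Real.fourier_real_eq_integral_exp_smul]
    congr 1
    ext ξ
    rw [smul_eq_mul, mul_left_comm]
    congr 3
    push_cast
    ring
  rw [integral_zero] at h1
  have h3 := h1.add h2
  rw [add_zero] at h3
  refine h3.congr' ?_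
  filter_upwards [eventually_ge_atTop 1] with x hx
  have hcx := continuous_vertical hh (inv_nonneg.2 (zero_le_one.trans hx))
  rw [← integral_add]
  · congr 1
    ext ξ
    ring
  · refine ((hwi.norm.const_mul M).add (hwi.norm.const_mul M)).mono'
      ((hcx.sub hc0).mul (by fun_prop)).aestronglyMeasurable (ae_of_all _ fun ξ => ?_)
    rw [sub_mul]
    exact (norm_sub_le _ _).trans (add_le_add (hmaj x hx ξ) (hmaj0 x ξ))
  · exact (hwi.norm.const_mul M).mono' (hc0.mul (by fun_prop)).aestronglyMeasurable
      (ae_of_all _ (hmaj0 x))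

/-- The contribution of a factor `h z / z ^ j` with `j ≤ k` to a vertical integral close to the
imaginary axis has order of magnitude smaller than `x ^ k`. -/
theorem tendsto_vertical_integral_div_pow_zero {h : ℂ → ℂ}
    (hh : ContinuousOn h {z : ℂ | 0 ≤ z.re}) {w : ℝ → ℂ} (hw : Continuous w)
    (hws : HasCompactSupport w) {j k : ℕ} (hjk : j ≤ k) :
    Tendsto (fun x : ℝ => ((x : ℂ) ^ k)⁻¹ * ∫ ξ : ℝ,
      h ((x⁻¹ : ℝ) + 2 * Real.pi * ξ * Complex.I) /
        ((x⁻¹ : ℝ) + 2 * Real.pi * ξ * Complex.I) ^ j *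
        (Complex.exp (2 * Real.pi * ξ * x * Complex.I) * w ξ)) atTop (𝓝 0) := by
  have hwi : Integrable w := hw.integrable_of_hasCompactSupport hws
  rcases Nat.eq_zero_or_pos j with rfl | hj
  · have h0 := tendsto_vertical_integral_zero hh hw hws
    rw [tendsto_zero_iff_norm_tendsto_zero] at h0 ⊢
    refine squeeze_zero' (Eventually.of_forall fun _ => norm_nonneg _) ?_ h0
    filter_upwards [eventually_ge_atTop 1] with x hx
    simp only [pow_zero, div_one]
    rw [norm_mul, norm_inv, norm_pow, Complex.norm_real, Real.norm_eq_abs,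
      abs_of_nonneg (zero_le_one.trans hx)]
    exact mul_le_of_le_one_left (norm_nonneg _) (inv_le_one_of_one_le₀ (one_le_pow₀ hx))
  obtain ⟨M, hM0, hM⟩ := exists_bound_vertical hh hws
  have hne : ∀ x : ℝ, 1 ≤ x → ∀ ξ : ℝ, ((x⁻¹ : ℝ) + 2 * Real.pi * ξ * Complex.I : ℂ) ≠ 0 := by
    intro x hx ξ h0
    have := congrArg Complex.re h0
    simp at this
    linarith
  simp only [← integral_const_mul]
  rw [← integral_zero ℝ ℂ (μ := volume)]
  refine tendsto_integral_filter_of_dominated_convergence (fun ξ => M * ‖w ξ‖)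
      ?_ ?_ (hwi.norm.const_mul M) ?_
  · filter_upwards [eventually_ge_atTop 1] with x hx
    have := continuous_vertical hh (inv_nonneg.2 (zero_le_one.trans hx))
    have hp : Continuous fun ξ : ℝ => h ((x⁻¹ : ℝ) + 2 * Real.pi * ξ * Complex.I) /
        ((x⁻¹ : ℝ) + 2 * Real.pi * ξ * Complex.I) ^ j :=
      this.div (by fun_prop) fun ξ => pow_ne_zero _ (hne x hx ξ)
    exact (by fun_prop : Continuous _).aestronglyMeasurable
  · filter_upwards [eventually_ge_atTop 1] with x hx
    refine ae_of_all _ fun ξ => ?_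
    have hx0 : 0 < x := zero_lt_one.trans_le hx
    have h1 := hM x⁻¹ (by positivity) (inv_le_one_of_one_le₀ hx) ξ
    have h2 : x⁻¹ ≤ ‖((x⁻¹ : ℝ) + 2 * Real.pi * ξ * Complex.I : ℂ)‖ := by
      refine le_trans (le_of_eq ?_) (Complex.re_le_norm _)
      simp
    have h3 : (x ^ k)⁻¹ / ‖((x⁻¹ : ℝ) + 2 * Real.pi * ξ * Complex.I : ℂ)‖ ^ j ≤ 1 := by
      rw [div_le_one (pow_pos ((inv_pos.2 hx0).trans_le h2) _)]
      calc (x ^ k)⁻¹ = x⁻¹ ^ k := (inv_pow _ _).symm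
        _ ≤ x⁻¹ ^ j := pow_le_pow_of_le_one (by positivity) (inv_le_one_of_one_le₀ hx) hjk
        _ ≤ _ := by gcongr
    rw [norm_mul, norm_mul, norm_mul, norm_cexp_two_pi_mul, one_mul, norm_inv, norm_pow, norm_div,
      norm_pow, Complex.norm_real, Real.norm_eq_abs, abs_of_pos hx0]
    rw [norm_mul] at h1
    calc _ = (x ^ k)⁻¹ / ‖((x⁻¹ : ℝ) + 2 * Real.pi * ξ * Complex.I : ℂ)‖ ^ j *
          (‖h ((x⁻¹ : ℝ) + 2 * Real.pi * ξ * Complex.I)‖ * ‖w ξ‖) := by ring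
      _ ≤ 1 * (M * ‖w ξ‖) := mul_le_mul h3 h1 (by positivity) zero_le_one
      _ = _ := one_mul _
  · filter_upwards [Measure.ae_ne volume 0] with ξ hξ
    have hid : ContinuousOn (fun z : ℂ => z) {z : ℂ | 0 ≤ z.re} := continuousOn_id
    have h1 := (tendsto_vertical hh ξ).div ((tendsto_vertical hid ξ).pow j)
      (pow_ne_zero _ (by simpa using hξ))
    have h2 : Tendsto (fun x : ℝ => (x ^ k)⁻¹) atTop (𝓝 0) :=
      tendsto_inv_atTop_zero.comp (tendsto_pow_atTop (hj.trans_le hjk).ne')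
    have h3 := (h2.mul h1.norm).mul_const ‖w ξ‖
    rw [zero_mul, zero_mul] at h3
    rw [tendsto_zero_iff_norm_tendsto_zero]
    refine h3.congr' ?_
    filter_upwards [eventually_ge_atTop 1] with x hx
    rw [norm_mul, norm_mul, norm_mul, norm_cexp_two_pi_mul, one_mul, norm_inv, norm_pow,
      Complex.norm_real, Real.norm_eq_abs, abs_of_pos (zero_lt_one.trans_le hx), mul_assoc, Pi.div_apply]

theorem tendsto_smoothed_pow (k : ℕ) {K : ℝ → ℝ} (hKc : Continuous K) (hK : Integrable K) :
    Tendsto (fun x : ℝ => (x ^ k)⁻¹ *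
      ∫ y in Set.Ioi (0 : ℝ), y ^ k * Real.exp (-x⁻¹ * y) * K (y - x)) atTop
      (𝓝 (Real.exp (-1) * ∫ v, K v)) := by
  have h1 : Tendsto (fun x : ℝ => ∫ v, (Set.Ioi (0 : ℝ)).indicator
      (fun y => (x⁻¹ * y) ^ k * Real.exp (-(x⁻¹ * y))) (v + x) * K v) atTop
      (𝓝 (∫ v, Real.exp (-1) * K v)) := by
    refine tendsto_integral_filter_of_dominated_convergence (fun v => k.factorial * ‖K v‖)
      (Eventually.of_forall fun x => ?_) ?_ (hK.norm.const_mul _) (ae_of_all _ fun v => ?_)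
    · refine (Measurable.mul ?_ hKc.measurable).aestronglyMeasurable
      exact (Measurable.indicator (by fun_prop) measurableSet_Ioi).comp (measurable_add_const x)
    · filter_upwards [eventually_gt_atTop 0] with x hx
      refine ae_of_all _ fun v => ?_
      rw [norm_mul]
      gcongr
      by_cases hv : v + x ∈ Set.Ioi (0 : ℝ)
      · rw [Set.indicator_of_mem hv]
        have ht : 0 ≤ x⁻¹ * (v + x) := mul_nonneg (inv_nonneg.2 hx.le) (le_of_lt hv)
        rw [Real.norm_of_nonneg (by positivity), Real.exp_neg, ← div_eq_mul_inv,
          div_le_iff₀ (Real.exp_pos _), ← div_le_iff₀' (by positivity)]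
        exact Real.pow_div_factorial_le_exp _ ht k
      · rw [Set.indicator_of_notMem hv, norm_zero]
        positivity
    · have h2 : Tendsto (fun x : ℝ => x⁻¹ * (v + x)) atTop (𝓝 1) := by
        have := (tendsto_inv_atTop_zero.mul_const v).add_const 1
        rw [zero_mul, zero_add] at this
        refine this.congr' ?_
        filter_upwards [eventually_gt_atTop 0] with x hx
        rw [mul_add, inv_mul_cancel₀ hx.ne']
      have h3 := (((h2.pow k).mul (Real.continuous_exp.tendsto _ |>.comp h2.neg))).mul_const (K v)
      rw [one_pow, one_mul] at h3
      refine h3.congr' ?_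
      filter_upwards [eventually_gt_atTop (-v)] with x hx
      rw [Set.indicator_of_mem (show v + x ∈ Set.Ioi (0 : ℝ) from by simp only [Set.mem_Ioi]; linarith)]
      rfl
  rw [integral_const_mul] at h1
  refine h1.congr fun x => ?_
  rw [← integral_sub_right_eq_self _ x, ← integral_indicator measurableSet_Ioi,
    ← integral_const_mul]
  congr 1
  ext y
  rw [sub_add_cancel]
  by_cases hy : y ∈ Set.Ioi (0 : ℝ)
  · rw [Set.indicator_of_mem hy, Set.indicator_of_mem hy, mul_pow, inv_pow, neg_mul]
    ring
  · rw [Set.indicator_of_notMem hy, Set.indicator_of_notMem hy, zero_mul, mul_zero]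

theorem tendsto_smoothed {A : ℝ → ℝ}
    (hA : ∀ ε : ℝ, 0 < ε → Integrable fun y => A y * Real.exp (-ε * y))
    {L : ℝ} {k : ℕ} {h : ℕ → ℂ → ℂ} (hh : ∀ j, ContinuousOn (h j) {z : ℂ | 0 ≤ z.re})
    (hLap : ∀ z : ℂ, 0 < z.re → ∫ y, (A y : ℂ) * Complex.exp (-z * y) =
      L / z ^ (k + 1) + ∑ j ∈ Finset.range (k + 1), h j z / z ^ j)
    {w : ℝ → ℂ} (hw : Continuous w) (hws : HasCompactSupport w)
    {K : ℝ → ℝ} (hwK : ∀ v, 𝓕 w v = K v) (hKc : Continuous K) (hK : Integrable K) :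
    (∀ ε x : ℝ, 0 < ε → Integrable fun y => A y * Real.exp (-ε * y) * K (y - x)) ∧
    Tendsto (fun x : ℝ => (x ^ k)⁻¹ * ∫ y, A y * Real.exp (-x⁻¹ * y) * K (y - x)) atTop
      (𝓝 (L / k.factorial * (Real.exp (-1) * ∫ v, K v))) := by
  have hKb : ∀ v, ‖K v‖ ≤ ∫ ξ, ‖w ξ‖ := fun v => by
    rw [← Complex.norm_real, ← hwK]
    exact VectorFourier.norm_fourierIntegral_le_integral_norm _ _ _ _ _
  have hmul : ∀ {f : ℝ → ℝ} (x : ℝ), Integrable f → Integrable fun y => f y * K (y - x) :=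
    fun x hf => hf.mul_bdd (hKc.comp (continuous_sub_right x)).aestronglyMeasurable
      (ae_of_all _ fun y => hKb (y - x))
  refine ⟨fun ε x hε => hmul x (hA ε hε), ?_⟩
  set P : ℝ → ℝ := (Set.Ioi (0 : ℝ)).indicator fun y => L / k.factorial * y ^ k with hP
  have hPexp : ∀ ε y : ℝ, P y * Real.exp (-ε * y) = (Set.Ioi (0 : ℝ)).indicator
      (fun y => L / k.factorial * (y ^ k * Real.exp (-ε * y))) y := by
    intro ε y
    by_cases hy : y ∈ Set.Ioi (0 : ℝ)
    · rw [hP, Set.indicator_of_mem hy, Set.indicator_of_mem hy, mul_assoc]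
    · rw [hP, Set.indicator_of_notMem hy, Set.indicator_of_notMem hy, zero_mul]
  have hPcexp : ∀ (z : ℂ) (y : ℝ), (P y : ℂ) * Complex.exp (-z * y) = (Set.Ioi (0 : ℝ)).indicator
      (fun y : ℝ => (L / k.factorial : ℂ) * ((y : ℂ) ^ k * Complex.exp (-z * y))) y := by
    intro z y
    by_cases hy : y ∈ Set.Ioi (0 : ℝ)
    · rw [hP, Set.indicator_of_mem hy, Set.indicator_of_mem hy]
      push_cast
      ring
    · rw [hP, Set.indicator_of_notMem hy, Set.indicator_of_notMem hy, Complex.ofReal_zero, zero_mul]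
  have hPi : ∀ ε : ℝ, 0 < ε → Integrable fun y => P y * Real.exp (-ε * y) := by
    intro ε hε
    simp only [hPexp]
    exact (integrable_indicator_iff measurableSet_Ioi).2
      ((integrableOn_pow_mul_exp_neg_mul k hε).const_mul _)
  have hPLap : ∀ z : ℂ, 0 < z.re → ∫ y, (P y : ℂ) * Complex.exp (-z * y) = L / z ^ (k + 1) := by
    intro z hz
    simp only [hPcexp]
    rw [integral_indicator measurableSet_Ioi, integral_const_mul,
      integral_pow_mul_cexp_neg_mul k hz]
    have : (k.factorial : ℂ) ≠ 0 := Nat.cast_ne_zero.2 k.factorial_ne_zero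
    field_simp
  have hcplx : ∀ {f : ℝ → ℝ}, (∀ ε : ℝ, 0 < ε → Integrable fun y => f y * Real.exp (-ε * y)) →
      ∀ z : ℂ, 0 < z.re → Integrable fun y : ℝ => (f y : ℂ) * Complex.exp (-z * y) := by
    intro f hf z hz
    have h1 := ((hf z.re hz).ofReal (𝕜 := ℂ)).mul_bdd (c := 1)
      (g := fun y : ℝ => Complex.exp (-(z.im * y : ℝ) * Complex.I))
      (by fun_prop : Continuous _).aestronglyMeasurable
      (ae_of_all _ fun y => by
        rw [← Complex.ofReal_neg, Complex.norm_exp_ofReal_mul_I])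
    refine h1.congr (ae_of_all _ fun y => ?_)
    simp only [Complex.coe_algebraMap, Complex.ofReal_mul, Complex.ofReal_exp]
    rw [mul_assoc, ← Complex.exp_add]
    congr 2
    conv_rhs => rw [← Complex.re_add_im z]
    push_cast
    ring
  have hD : ∀ z : ℂ, 0 < z.re → ∫ y, ((A y : ℂ) - P y) * Complex.exp (-z * y) =
      ∑ j ∈ Finset.range (k + 1), h j z / z ^ j := by
    intro z hz
    simp only [sub_mul]
    rw [integral_sub (hcplx hA z hz) (hcplx hPi z hz), hLap z hz, hPLap z hz, add_sub_cancel_left]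
  have hre : ∀ (x ξ : ℝ), 0 < x → 0 < ((x⁻¹ : ℝ) + 2 * Real.pi * ξ * Complex.I : ℂ).re := by
    intro x ξ hx
    simpa using hx
  obtain hsum := tendsto_finsetSum (Finset.range (k + 1)) fun j hj =>
    tendsto_vertical_integral_div_pow_zero (hh j) hw hws
      (Nat.lt_succ_iff.1 (Finset.mem_range.1 hj))
  have hdiff : Tendsto (fun x : ℝ => (((x ^ k)⁻¹ * ((∫ y, A y * Real.exp (-x⁻¹ * y) * K (y - x)) -
      ∫ y, P y * Real.exp (-x⁻¹ * y) * K (y - x)) : ℝ) : ℂ)) atTop (𝓝 0) := by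
    rw [Finset.sum_const_zero] at hsum
    refine hsum.congr' ?_
    filter_upwards [eventually_gt_atTop 0] with x hx
    have hx' : 0 < x⁻¹ := inv_pos.2 hx
    rw [← integral_sub (hmul x (hA _ hx')) (hmul x (hPi _ hx')), ← Finset.mul_sum,
      Complex.ofReal_mul, ← integral_complex_ofReal]
    push_cast
    congr 1
    have e1 := integral_mul_fourier_sub_eq (D := fun y => (A y : ℂ) - P y) (ε := x⁻¹) (by
      simp only [sub_mul]
      exact (hcplx hA (x⁻¹ : ℝ) (by simpa using hx)).sub (hcplx hPi (x⁻¹ : ℝ) (by simpa using hx)))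
      hw hws x
    rw [← integral_finsetSum]
    · refine Eq.trans ?_ (e1.symm.trans ?_)
      · congr 1
        ext ξ
        rw [hD _ (hre x ξ hx), Finset.sum_mul]
        push_cast
        rfl
      · congr 1
        ext y
        rw [hwK]
        push_cast
        ring
    · intro j _
      have hcx := continuous_vertical (hh j) hx'.le
      have hp : Continuous fun ξ : ℝ => h j ((x⁻¹ : ℝ) + 2 * Real.pi * ξ * Complex.I) /
          ((x⁻¹ : ℝ) + 2 * Real.pi * ξ * Complex.I) ^ j :=
        hcx.div (by fun_prop) fun ξ => pow_ne_zero _ fun h0 => by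
          have := hre x ξ hx
          rw [h0] at this
          simp at this
      push_cast at hp
      exact (hp.mul (by fun_prop)).integrable_of_hasCompactSupport hws.mul_left.mul_left
  have hdiff' := (Complex.continuous_re.tendsto 0).comp hdiff
  have hmain := (tendsto_smoothed_pow k hKc hK).const_mul (L / k.factorial)
  have := hdiff'.add hmain
  rw [Complex.zero_re, zero_add] at this
  refine this.congr fun x => ?_
  have e2 : ∫ y, P y * Real.exp (-x⁻¹ * y) * K (y - x) = L / k.factorial *
      ∫ y in Set.Ioi (0 : ℝ), y ^ k * Real.exp (-x⁻¹ * y) * K (y - x) := by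
    rw [← integral_const_mul, ← integral_indicator measurableSet_Ioi]
    congr 1
    ext y
    rw [hPexp]
    by_cases hy : y ∈ Set.Ioi (0 : ℝ)
    · rw [Set.indicator_of_mem hy, Set.indicator_of_mem hy, mul_assoc]
    · rw [Set.indicator_of_notMem hy, Set.indicator_of_notMem hy, zero_mul]
  rw [Function.comp_apply, Complex.ofReal_re, e2]
  ring

theorem setIntegral_Ioc_comp_sub {t : ℝ} (ht : 0 < t) (x : ℝ) (K : ℝ → ℝ) :
    ∫ y in Set.Ioc (x - t) (x + t), K (y - x) = ∫ v in Set.Ioc (-t) t, K v := by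
  rw [← intervalIntegral.integral_of_le (by linarith), ← intervalIntegral.integral_of_le
    (by linarith), intervalIntegral.integral_comp_sub_right]
  congr 1 <;> ring

theorem smoothed_ge {A K : ℝ → ℝ} (hA0 : ∀ y, 0 ≤ A y) {c : ℝ} (hc : 0 < c)
    (hmono : Monotone fun y => Real.exp (c * y) * A y) (hK0 : ∀ v, 0 ≤ K v) (hK : Integrable K)
    {x t : ℝ} (ht : 0 < t) (hx : 0 < x)
    (hi : Integrable fun y => A y * Real.exp (-x⁻¹ * y) * K (y - x)) :
    A (x - t) * Real.exp (-(2 * c * t)) * Real.exp (-(1 + t / x)) *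
      ∫ v in Set.Ioc (-t) t, K v ≤ ∫ y, A y * Real.exp (-x⁻¹ * y) * K (y - x) := by
  rw [← setIntegral_Ioc_comp_sub ht x, ← integral_const_mul]
  refine le_trans (setIntegral_mono_on ((hK.comp_sub_right x).const_mul _).integrableOn
    hi.integrableOn measurableSet_Ioc fun y hy => ?_) (setIntegral_le_integral hi
    (ae_of_all _ fun y => mul_nonneg (mul_nonneg (hA0 y) (Real.exp_pos _).le) (hK0 _)))
  have h1 : A (x - t) * Real.exp (-(2 * c * t)) ≤ A y := by
    have := hmono hy.1.le
    simp only at this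
    rw [← mul_le_mul_iff_right₀ (Real.exp_pos (c * y))]
    refine le_trans ?_ this
    rw [mul_left_comm, ← Real.exp_add, mul_comm]
    gcongr
    · exact hA0 _
    · nlinarith [hy.2]
  have h2 : Real.exp (-(1 + t / x)) ≤ Real.exp (-x⁻¹ * y) := by
    rw [Real.exp_le_exp, neg_mul, neg_le_neg_iff, inv_mul_le_iff₀ hx, mul_add, mul_one,
      mul_div_cancel₀ _ hx.ne']
    exact hy.2
  exact mul_le_mul_of_nonneg_right (mul_le_mul h1 h2 (Real.exp_pos _).le (hA0 y)) (hK0 _)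

theorem smoothed_le {A K : ℝ → ℝ} (hA0 : ∀ y, 0 ≤ A y) (hAneg : ∀ y < 0, A y = 0) {c : ℝ}
    (hc : 0 < c) (hmono : Monotone fun y => Real.exp (c * y) * A y) {C : ℝ} (hC : 0 ≤ C) {k : ℕ}
    (hAC : ∀ y, 0 ≤ y → A y ≤ C * (1 + y) ^ k)
    (hK0 : ∀ v, 0 ≤ K v) (hK : Integrable K) (hK1 : ∫ v, K v = 1)
    {x t : ℝ} (ht : 0 < t) (hx : 1 ≤ x) (hKt : 1 - t ≤ ∫ v in Set.Ioc (-t) t, K v)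
    (hi : Integrable fun y => A y * Real.exp (-x⁻¹ * y) * K (y - x)) :
    ∫ y, A y * Real.exp (-x⁻¹ * y) * K (y - x) ≤
      A (x + t) * Real.exp (2 * c * t) * Real.exp (-(1 - t / x)) +
        C * k.factorial * Real.exp 1 * x ^ k * t := by
  have hx0 : 0 < x := zero_lt_one.trans_le hx
  have hKx := hK.comp_sub_right x
  have hKsum := integral_add_compl (measurableSet_Ioc (a := x - t) (b := x + t)) hKx
  rw [integral_sub_right_eq_self (μ := volume) K x, hK1, setIntegral_Ioc_comp_sub ht x] at hKsum
  have hcompl0 : 0 ≤ ∫ y in (Set.Ioc (x - t) (x + t))ᶜ, K (y - x) :=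
    integral_nonneg fun y => hK0 _
  rw [← integral_add_compl (measurableSet_Ioc (a := x - t) (b := x + t)) hi]
  refine add_le_add ?_ ?_
  · calc ∫ y in Set.Ioc (x - t) (x + t), A y * Real.exp (-x⁻¹ * y) * K (y - x)
        ≤ ∫ y in Set.Ioc (x - t) (x + t),
          A (x + t) * Real.exp (2 * c * t) * Real.exp (-(1 - t / x)) * K (y - x) := by
          refine setIntegral_mono_on hi.integrableOn (hKx.const_mul _).integrableOn
            measurableSet_Ioc fun y hy => ?_
          have h1 : A y ≤ A (x + t) * Real.exp (2 * c * t) := by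
            have := hmono hy.2
            simp only at this
            rw [← mul_le_mul_iff_right₀ (Real.exp_pos (c * y))]
            refine le_trans this ?_
            rw [mul_left_comm, ← Real.exp_add, mul_comm]
            gcongr
            · exact hA0 _
            · nlinarith [hy.1]
          have h2 : Real.exp (-x⁻¹ * y) ≤ Real.exp (-(1 - t / x)) := by
            rw [Real.exp_le_exp, neg_mul, neg_le_neg_iff, le_inv_mul_iff₀ hx0, mul_sub, mul_one,
              mul_div_cancel₀ _ hx0.ne']
            exact hy.1.le
          exact mul_le_mul_of_nonneg_right (mul_le_mul h1 h2 (Real.exp_pos _).le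
            (mul_nonneg (hA0 _) (Real.exp_pos _).le)) (hK0 _)
      _ ≤ _ := by
          rw [integral_const_mul, setIntegral_Ioc_comp_sub ht x]
          exact mul_le_of_le_one_right (mul_nonneg (mul_nonneg (hA0 _) (Real.exp_pos _).le)
            (Real.exp_pos _).le) (by linarith)
  · calc ∫ y in (Set.Ioc (x - t) (x + t))ᶜ, A y * Real.exp (-x⁻¹ * y) * K (y - x)
        ≤ ∫ y in (Set.Ioc (x - t) (x + t))ᶜ, C * k.factorial * Real.exp 1 * x ^ k * K (y - x) := by
          refine setIntegral_mono hi.integrableOn (hKx.const_mul _).integrableOn fun y => ?_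
          refine mul_le_mul_of_nonneg_right ?_ (hK0 _)
          rcases lt_or_ge y 0 with hy | hy
          · rw [hAneg y hy, zero_mul]
            positivity
          have h1 : (1 + y) ^ k ≤ x ^ k * (1 + x⁻¹ * y) ^ k := by
            rw [← mul_pow, mul_add, mul_inv_cancel_left₀ hx0.ne', mul_one]
            gcongr
          have h2 : (1 + x⁻¹ * y) ^ k ≤ k.factorial * (Real.exp 1 * Real.exp (x⁻¹ * y)) := by
            rw [← Real.exp_add, ← div_le_iff₀' (by positivity)]
            exact Real.pow_div_factorial_le_exp _ (by positivity) k
          calc A y * Real.exp (-x⁻¹ * y)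
              ≤ C * (x ^ k * (k.factorial * (Real.exp 1 * Real.exp (x⁻¹ * y)))) *
                Real.exp (-x⁻¹ * y) := by
                gcongr
                exact (hAC y hy).trans (by gcongr; exact h1.trans (by gcongr))
            _ = _ := by
                rw [neg_mul, Real.exp_neg]
                field_simp
      _ ≤ _ := by
          rw [integral_const_mul]
          gcongr
          linarith

/-- A Tauberian theorem of Wiener-Ikehara-Delange type for Laplace transforms. -/
theorem tendsto_div_pow_of_laplace {A : ℝ → ℝ} (hA0 : ∀ y, 0 ≤ A y) (hAneg : ∀ y < 0, A y = 0)
    {c : ℝ} (hc : 0 < c) (hmono : Monotone fun y => Real.exp (c * y) * A y)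
    (hA : ∀ ε : ℝ, 0 < ε → Integrable fun y => A y * Real.exp (-ε * y))
    {L : ℝ} {k : ℕ} {h : ℕ → ℂ → ℂ} (hh : ∀ j, ContinuousOn (h j) {z : ℂ | 0 ≤ z.re})
    (hLap : ∀ z : ℂ, 0 < z.re → ∫ y, (A y : ℂ) * Complex.exp (-z * y) =
      L / z ^ (k + 1) + ∑ j ∈ Finset.range (k + 1), h j z / z ^ j) :
    Tendsto (fun x => A x / x ^ k) atTop (𝓝 (L / k.factorial)) := by
  set l := L / k.factorial with hl
  have hratio : ∀ t : ℝ, Tendsto (fun x : ℝ => (x + t) / x) atTop (𝓝 1) := by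
    intro t
    have := (tendsto_inv_atTop_zero.mul_const t).const_add 1
    rw [zero_mul, add_zero] at this
    refine this.congr' ?_
    filter_upwards [eventually_gt_atTop 0] with x hx
    field_simp
  have hshift : ∀ t : ℝ, Tendsto (fun x : ℝ => x + t) atTop atTop := fun t =>
    tendsto_atTop_add_const_right _ _ tendsto_id
  have hdiv : ∀ t : ℝ, Tendsto (fun x : ℝ => t / (x + t)) atTop (𝓝 0) := fun t =>
    (hshift t).const_div_atTop t
  have hdiv' : ∀ t : ℝ, Tendsto (fun x : ℝ => t / (x + -t)) atTop (𝓝 0) := fun t =>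
    (hshift (-t)).const_div_atTop t
  have hupper : ∀ b, l < b → ∀ᶠ x in atTop, A x / x ^ k < b := by
    intro b hb
    have hcont : Tendsto (fun t : ℝ => l * Real.exp (2 * c * t) / (1 - t)) (𝓝[>] 0) (𝓝 l) := by
      have : ContinuousAt (fun t : ℝ => l * Real.exp (2 * c * t) / (1 - t)) 0 :=
        ContinuousAt.div (by fun_prop) (by fun_prop) (by norm_num)
      simpa [ContinuousAt] using this.tendsto.mono_left nhdsWithin_le_nhds
    obtain ⟨t, ⟨htb, ht1⟩, ht0⟩ := ((hcont.eventually (gt_mem_nhds hb)).and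
      (nhdsWithin_le_nhds (gt_mem_nhds one_pos))).and self_mem_nhdsWithin |>.exists
    replace ht0 : 0 < t := ht0
    obtain ⟨w, K, hw, hws, hwK, hKc, hK0, hK, hK1, hKt⟩ := exists_concentrated_kernel ht0 ht0
    obtain ⟨hi, hT⟩ := tendsto_smoothed hA hh hLap hw hws hwK hKc hK
    rw [hK1, mul_one, ← hl] at hT
    have hlim := ((((hT.comp (hshift t)).mul ((hratio t).pow k)).mul_const
      (Real.exp (2 * c * t) / (1 - t))).mul
      ((Real.continuous_exp.tendsto _).comp ((hdiv t).const_add 1)))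
    have hval : l * Real.exp (-1) * 1 ^ k * (Real.exp (2 * c * t) / (1 - t)) * Real.exp (1 + 0) =
        l * Real.exp (2 * c * t) / (1 - t) := by
      rw [one_pow, add_zero, Real.exp_neg]
      field_simp
    rw [hval] at hlim
    filter_upwards [hlim.eventually (gt_mem_nhds htb), eventually_gt_atTop 0] with x hx hx0
    refine lt_of_le_of_lt ?_ hx
    have hxt : 0 < x + t := by positivity
    have hge := smoothed_ge hA0 hc hmono hK0 hK ht0 hxt (hi _ _ (inv_pos.2 hxt))
    simp only [Function.comp_apply, add_sub_cancel_right] at hge ⊢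
    set T := ∫ y, A y * Real.exp (-(x + t)⁻¹ * y) * K (y - (x + t))
    have h1t : 0 < 1 - t := by linarith
    have hge' : A x * Real.exp (-(2 * c * t)) * Real.exp (-(1 + t / (x + t))) * (1 - t) ≤ T :=
      le_trans (mul_le_mul_of_nonneg_left hKt (mul_nonneg (mul_nonneg (hA0 x)
        (Real.exp_pos _).le) (Real.exp_pos _).le)) hge
    rw [Real.exp_neg, Real.exp_neg] at hge'
    calc A x / x ^ k = (A x * (Real.exp (2 * c * t))⁻¹ * (Real.exp (1 + t / (x + t)))⁻¹ * (1 - t)) *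
          (Real.exp (2 * c * t) * Real.exp (1 + t / (x + t)) / (1 - t) / x ^ k) := by
          field_simp
      _ ≤ T * (Real.exp (2 * c * t) * Real.exp (1 + t / (x + t)) / (1 - t) / x ^ k) := by
          gcongr
      _ = _ := by
          rw [div_pow]
          field_simp
  obtain ⟨C, hC, hAC⟩ : ∃ C : ℝ, 0 ≤ C ∧ ∀ y, 0 ≤ y → A y ≤ C * (1 + y) ^ k := by
    obtain ⟨X, hX⟩ := ((hupper (l + 1) (lt_add_one l)).and (eventually_gt_atTop 0)).exists_forall_of_atTop
    refine ⟨max (l + 1) (Real.exp (c * X) * A X), le_max_of_le_right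
      (mul_nonneg (Real.exp_pos _).le (hA0 _)), fun y hy => ?_⟩
    rcases le_or_gt X y with h | h
    · obtain ⟨h1, h2⟩ := hX y h
      rw [div_lt_iff₀ (pow_pos h2 k)] at h1
      have hM : 0 ≤ max (l + 1) (Real.exp (c * X) * A X) :=
        le_max_of_le_right (mul_nonneg (Real.exp_pos _).le (hA0 _))
      calc A y ≤ (l + 1) * y ^ k := h1.le
        _ ≤ max (l + 1) (Real.exp (c * X) * A X) * y ^ k := by gcongr; exact le_max_left _ _
        _ ≤ _ := by gcongr; linarith
    · have h1 := hmono h.le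
      simp only at h1
      calc A y ≤ Real.exp (c * y) * A y :=
            le_mul_of_one_le_left (hA0 y) (Real.one_le_exp (by positivity))
        _ ≤ max (l + 1) (Real.exp (c * X) * A X) := h1.trans (le_max_right _ _)
        _ ≤ _ := le_mul_of_one_le_right (le_max_of_le_right (mul_nonneg (Real.exp_pos _).le (hA0 _)))
            (one_le_pow₀ (by linarith))
  have hlower : ∀ b, b < l → ∀ᶠ x in atTop, b < A x / x ^ k := by
    intro b hb
    set C' := C * k.factorial * Real.exp 1 with hC'
    have hcont : Tendsto (fun t : ℝ => (l * Real.exp (-1) - C' * t) * Real.exp (-(2 * c * t)) *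
        Real.exp 1) (𝓝[>] 0) (𝓝 l) := by
      have h1 : ContinuousAt (fun t : ℝ => (l * Real.exp (-1) - C' * t) * Real.exp (-(2 * c * t)) *
        Real.exp 1) 0 := by fun_prop
      have h2 := h1.tendsto.mono_left (nhdsWithin_le_nhds (s := Set.Ioi 0))
      simpa [mul_assoc, ← Real.exp_add] using h2
    obtain ⟨t, htb, ht0⟩ := ((hcont.eventually (lt_mem_nhds hb)).and self_mem_nhdsWithin).exists
    replace ht0 : 0 < t := ht0
    obtain ⟨w, K, hw, hws, hwK, hKc, hK0, hK, hK1, hKt⟩ := exists_concentrated_kernel ht0 ht0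
    obtain ⟨hi, hT⟩ := tendsto_smoothed hA hh hLap hw hws hwK hKc hK
    rw [hK1, mul_one, ← hl] at hT
    have hlim := (((((hT.comp (hshift (-t))).sub_const (C' * t)).mul ((hratio (-t)).pow k)).mul_const
      (Real.exp (-(2 * c * t)))).mul
      ((Real.continuous_exp.tendsto _).comp ((hdiv' t).const_sub 1)))
    rw [one_pow, mul_one, sub_zero] at hlim
    filter_upwards [hlim.eventually (lt_mem_nhds htb), eventually_ge_atTop (1 + t)] with x hx hx0
    refine lt_of_lt_of_le hx ?_
    have hxt : 1 ≤ x + -t := by linarith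
    have hxt0 : 0 < x + -t := by linarith
    have hxp : 0 < x := by linarith
    have hle := smoothed_le hA0 hAneg hc hmono hC hAC hK0 hK hK1 ht0 hxt hKt
      (hi _ _ (inv_pos.2 hxt0))
    simp only [Function.comp_apply, neg_add_cancel_right, ← hC'] at hle ⊢
    set T := ∫ y, A y * Real.exp (-(x + -t)⁻¹ * y) * K (y - (x + -t))
    rw [Real.exp_neg (1 - _)] at hle
    rw [Real.exp_neg]
    calc _ = (T - C' * (x + -t) ^ k * t) *
          ((Real.exp (2 * c * t))⁻¹ * Real.exp (1 - t / (x + -t)) / x ^ k) := by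
          rw [div_pow]
          field_simp
      _ ≤ (A x * Real.exp (2 * c * t) * (Real.exp (1 - t / (x + -t)))⁻¹) *
          ((Real.exp (2 * c * t))⁻¹ * Real.exp (1 - t / (x + -t)) / x ^ k) := by
          gcongr
          linarith
      _ = _ := by
          field_simp
  exact tendsto_order.2 ⟨hlower, hupper⟩

/-- The summatory function of `f`, in which the `n`-th term sits at `n + 1`, in exponential
scale and weighted by `exp (-c * y)`. -/
noncomputable def expSummatory (f : ℕ → ℝ) (c y : ℝ) : ℝ :=
  Real.exp (-c * y) * ∑ n ∈ Finset.range ⌊Real.exp y⌋₊, f n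

theorem lt_floor_exp_iff (n : ℕ) (y : ℝ) : n < ⌊Real.exp y⌋₊ ↔ Real.log (n + 1) ≤ y := by
  rw [← Nat.succ_le_iff, Nat.le_floor_iff (Real.exp_pos y).le, Real.log_le_iff_le_exp (by positivity)]
  push_cast
  rfl

section

variable {f : ℕ → ℝ} {c : ℝ}

theorem expSummatory_nonneg (hf : ∀ n, 0 ≤ f n) (y : ℝ) : 0 ≤ expSummatory f c y :=
  mul_nonneg (Real.exp_pos _).le (Finset.sum_nonneg fun n _ => hf n)

theorem expSummatory_of_neg {y : ℝ} (hy : y < 0) : expSummatory f c y = 0 := by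
  rw [expSummatory, Nat.floor_eq_zero.2 (by simpa using hy)]
  simp

theorem exp_mul_expSummatory (f : ℕ → ℝ) (c y : ℝ) :
    Real.exp (c * y) * expSummatory f c y = ∑ n ∈ Finset.range ⌊Real.exp y⌋₊, f n := by
  rw [expSummatory, ← mul_assoc, ← Real.exp_add, neg_mul, add_neg_cancel, Real.exp_zero, one_mul]

theorem monotone_exp_mul_expSummatory (hf : ∀ n, 0 ≤ f n) :
    Monotone fun y => Real.exp (c * y) * expSummatory f c y := by
  intro x y hxy
  simp only [exp_mul_expSummatory]
  exact Finset.sum_le_sum_of_subset_of_nonneg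
    (Finset.range_mono (Nat.floor_mono (Real.exp_le_exp.2 hxy))) fun n _ _ => hf n

theorem expSummatory_le (hf : ∀ n, 0 ≤ f n) {ε : ℝ} (hε : 0 < c + ε)
    (hs : Summable fun n : ℕ => f n * Real.exp (-(c + ε) * Real.log (n + 1))) (y : ℝ) :
    expSummatory f c y ≤
      (∑' n : ℕ, f n * Real.exp (-(c + ε) * Real.log (n + 1))) * Real.exp (ε * y) := by
  rw [expSummatory, show -c * y = ε * y + -((c + ε) * y) by ring, Real.exp_add, mul_assoc, mul_comm]
  refine mul_le_mul_of_nonneg_right ?_ (Real.exp_pos _).le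
  rw [Finset.mul_sum]
  refine le_trans (Finset.sum_le_sum fun n hn => ?_)
    (hs.sum_le_tsum (Finset.range ⌊Real.exp y⌋₊)
      fun n _ => mul_nonneg (hf n) (Real.exp_pos _).le)
  rw [mul_comm, neg_mul]
  have := (lt_floor_exp_iff n y).1 (Finset.mem_range.1 hn)
  gcongr
  exact hf n

theorem integrable_expSummatory_mul_exp (hc : 0 < c) (hf : ∀ n, 0 ≤ f n)
    (hs : ∀ ε : ℝ, 0 < ε → Summable fun n : ℕ => f n * Real.exp (-(c + ε) * Real.log (n + 1)))
    {ε : ℝ} (hε : 0 < ε) : Integrable fun y => expSummatory f c y * Real.exp (-ε * y) := by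
  have hm : Measurable (expSummatory f c) := by
    have h1 := (monotone_exp_mul_expSummatory (c := c) hf).measurable
    have h2 : Measurable fun y : ℝ => Real.exp (-c * y) := by fun_prop
    convert h2.mul h1 using 1
    ext y
    simp only [Pi.mul_apply, exp_mul_expSummatory]
    rfl
  set M := ∑' n : ℕ, f n * Real.exp (-(c + ε / 2) * Real.log (n + 1))
  have hint : IntegrableOn (fun y : ℝ => M * Real.exp (-(ε / 2) * y)) (Set.Ici 0) :=
    (integrableOn_Ici_iff_integrableOn_Ioi).2
      ((integrableOn_exp_mul_Ioi (by linarith) 0).const_mul M)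
  refine ((integrable_indicator_iff measurableSet_Ici).2 hint).mono'
    (hm.mul (by fun_prop)).aestronglyMeasurable (ae_of_all _ fun y => ?_)
  rw [Real.norm_of_nonneg (mul_nonneg (expSummatory_nonneg hf y) (Real.exp_pos _).le)]
  by_cases hy : y ∈ Set.Ici (0 : ℝ)
  · rw [Set.indicator_of_mem hy]
    calc _ ≤ M * Real.exp (ε / 2 * y) * Real.exp (-ε * y) := by
          gcongr
          exact expSummatory_le hf (by linarith) (hs _ (by linarith)) y
      _ = _ := by
          rw [mul_assoc, ← Real.exp_add]
          ring_nf
  · rw [Set.indicator_of_notMem hy, expSummatory_of_neg (not_le.1 hy), zero_mul]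

theorem integral_expSummatory_mul_cexp (hc : 0 < c) (hf : ∀ n, 0 ≤ f n)
    (hs : ∀ ε : ℝ, 0 < ε → Summable fun n : ℕ => f n * Real.exp (-(c + ε) * Real.log (n + 1)))
    {z : ℂ} (hz : 0 < z.re) :
    ∫ y, (expSummatory f c y : ℂ) * Complex.exp (-z * y) =
      (∑' n : ℕ, f n * Complex.exp (-(c + z) * Real.log (n + 1))) / (c + z) := by
  have hre : (-(c + z) : ℂ).re < 0 := by
    simp
    linarith
  set F : ℕ → ℝ → ℂ := fun n => (Set.Ici (Real.log (n + 1))).indicator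
    fun y : ℝ => (f n : ℂ) * Complex.exp (-(c + z) * y) with hF
  have hFint : ∀ n, Integrable (F n) := fun n =>
    (integrable_indicator_iff measurableSet_Ici).2 ((integrableOn_Ici_iff_integrableOn_Ioi).2
      ((integrableOn_exp_mul_complex_Ioi hre _).const_mul _))
  have hFval : ∀ n, ∫ y, F n y =
      f n * Complex.exp (-(c + z) * Real.log (n + 1)) / (c + z) := by
    intro n
    rw [hF, integral_indicator measurableSet_Ici, integral_Ici_eq_integral_Ioi, integral_const_mul,
      integral_exp_mul_complex_Ioi hre, neg_div_neg_eq, mul_div_assoc]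
  have hFnorm : ∀ n, ∫ y, ‖F n y‖ =
      f n * Real.exp (-(c + z.re) * Real.log (n + 1)) / (c + z.re) := by
    intro n
    have : ∀ y, ‖F n y‖ = (Set.Ici (Real.log (n + 1))).indicator
        (fun y : ℝ => f n * Real.exp (-(c + z.re) * y)) y := by
      intro y
      rw [hF, norm_indicator_eq_indicator_norm]
      congr 1
      ext y
      rw [norm_mul, norm_cexp_neg_mul_ofReal, Complex.norm_real, Real.norm_of_nonneg (hf n)]
      simp
    simp only [this]
    rw [integral_indicator measurableSet_Ici, integral_Ici_eq_integral_Ioi, integral_const_mul,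
      integral_exp_mul_Ioi (by linarith), neg_div_neg_eq, mul_div_assoc]
  have key := hasSum_integral_of_summable_integral_norm hFint (by
    simp only [hFnorm]
    exact (hs _ hz).div_const _)
  simp only [hFval] at key
  rw [← tsum_div_const, key.tsum_eq]
  congr 1
  ext y
  rw [tsum_eq_sum (s := Finset.range ⌊Real.exp y⌋₊), expSummatory]
  · push_cast
    rw [mul_right_comm, ← Complex.exp_add, Finset.mul_sum]
    refine Finset.sum_congr rfl fun n hn => ?_
    simp only [hF]
    rw [Set.indicator_of_mem
      (show y ∈ Set.Ici _ from (lt_floor_exp_iff n y).1 (Finset.mem_range.1 hn)), mul_comm]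
    ring_nf
  · intro n hn
    simp only [hF]
    rw [Set.indicator_of_notMem]
    exact fun h => hn (Finset.mem_range.2 ((lt_floor_exp_iff n y).2 h))

/-- A Tauberian theorem of Delange type for Dirichlet series with nonnegative coefficients. -/
theorem tendsto_expSummatory_div_pow (hc : 0 < c) (hf : ∀ n, 0 ≤ f n)
    (hs : ∀ ε : ℝ, 0 < ε → Summable fun n : ℕ => f n * Real.exp (-(c + ε) * Real.log (n + 1)))
    {γ : ℝ} {k : ℕ} {ν : ℕ → ℂ} {Ψ : ℂ → ℂ} (hΨ : ContinuousOn Ψ {z : ℂ | 0 ≤ z.re})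
    (hval : ∀ z : ℂ, 0 < z.re → ∑' n : ℕ, f n * Complex.exp (-(c + z) * Real.log (n + 1)) =
      γ / z ^ (k + 1) + (∑ j ∈ Finset.Icc 1 k, ν j / z ^ j) + Ψ z) :
    Tendsto (fun x => expSummatory f c x / x ^ k) atTop (𝓝 (γ / c / k.factorial)) := by
  have hcz : ∀ z : ℂ, 0 ≤ z.re → (c + z : ℂ) ≠ 0 := by
    intro z hz h0
    have := congrArg Complex.re h0
    simp at this
    linarith
  refine tendsto_div_pow_of_laplace (expSummatory_nonneg hf) (fun y => expSummatory_of_neg) hc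
    (monotone_exp_mul_expSummatory hf) (fun ε hε => integrable_expSummatory_mul_exp hc hf hs hε)
    (h := fun j z => (if j = 0 then Ψ z else ν j) / (c + z) +
      (if j = k then -(γ / c : ℂ) else 0) / (c + z)) ?_ ?_
  · intro j
    have hd : ContinuousOn (fun z : ℂ => (c + z : ℂ)) {z : ℂ | 0 ≤ z.re} := by fun_prop
    refine ContinuousOn.add (ContinuousOn.div ?_ hd hcz) (ContinuousOn.div (by fun_prop) hd hcz)
    split_ifs
    · exact hΨ
    · fun_prop
  · intro z hz
    have hz0 : z ≠ 0 := by
      rintro rfl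
      simp at hz
    have hcz' := hcz z hz.le
    have hc' : (c : ℂ) ≠ 0 := Complex.ofReal_ne_zero.2 hc.ne'
    rw [integral_expSummatory_mul_cexp hc hf hs hz, hval z hz]
    simp only [add_div, Finset.sum_add_distrib]
    have e1 : ∑ j ∈ Finset.range (k + 1), (if j = k then -(γ / c : ℂ) else 0) / (c + z) / z ^ j =
        -(γ / c : ℂ) / (c + z) / z ^ k := by
      rw [Finset.sum_eq_single k]
      · simp
      · intro j _ hj
        simp [hj]
      · simp
    have e2 : ∑ j ∈ Finset.range (k + 1), (if j = 0 then Ψ z else ν j) / (c + z) / z ^ j =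
        (∑ j ∈ Finset.Icc 1 k, ν j / z ^ j) / (c + z) + Ψ z / (c + z) := by
      rw [Finset.sum_range_succ', ← Finset.Ico_add_one_right_eq_Icc, Finset.sum_Ico_eq_sum_range,
        Finset.sum_div]
      simp only [Nat.add_sub_cancel, if_true, pow_zero, div_one, Nat.add_eq_zero_iff, one_ne_zero,
        and_false, if_false]
      congr 1
      refine Finset.sum_congr rfl fun j _ => ?_
      rw [add_comm 1 j, div_right_comm]
    rw [e1, e2]
    push_cast
    field_simp
    ring

end

theorem sum_Icc_eq_rpow_mul_expSummatory (g : ℕ → ℝ) (c : ℝ) {N : ℕ} (hN : 0 < N) :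
    ∑ n ∈ Finset.Icc 1 N, g n =
      (N : ℝ) ^ c * expSummatory (fun n => g (n + 1)) c (Real.log N) := by
  have hN' : (0 : ℝ) < N := Nat.cast_pos.2 hN
  rw [Real.rpow_def_of_pos hN', mul_comm (Real.log _) c, exp_mul_expSummatory, Real.exp_log hN',
    Nat.floor_natCast, ← Finset.Ico_add_one_right_eq_Icc, Finset.sum_Ico_eq_sum_range]
  simp [add_comm]

theorem natCast_rpow_eq_exp (n : ℕ) (x : ℝ) :
    ((n + 1 : ℕ) : ℝ) ^ x = Real.exp (x * Real.log (n + 1)) := by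
  rw [Real.rpow_def_of_pos (by positivity), mul_comm]
  push_cast
  rfl

theorem natCast_cpow_eq_cexp (n : ℕ) (z : ℂ) :
    ((n + 1 : ℕ) : ℂ) ^ z = Complex.exp (z * Real.log (n + 1)) := by
  rw [Complex.cpow_def_of_ne_zero (Nat.cast_ne_zero.2 n.succ_ne_zero), ← Complex.natCast_log,
    mul_comm]
  push_cast
  rfl

theorem partial_sum_asymptotics
    (G : Type*) [Group G] [Group.FG G]
    (α : ℝ) (hα : 0 < α) (m : ℕ) (hm : 1 ≤ m) (γ : ℝ) (hγ : 0 < γ)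
    (ν : ℕ → ℂ) (Φ : ℂ → ℂ)
    (hΦc : ContinuousOn Φ {s : ℂ | α ≤ s.re})
    (hΦd : DifferentiableOn ℂ Φ {s : ℂ | α < s.re})
    (hsum : ∀ s : ℂ, α < s.re →
      Summable fun δ : ℕ => ‖(aCount G (δ + 1) : ℂ) * ((δ + 1 : ℕ) : ℂ) ^ (-s)‖)
    (hval : ∀ s : ℂ, α < s.re →
      ∑' δ : ℕ, (aCount G (δ + 1) : ℂ) * ((δ + 1 : ℕ) : ℂ) ^ (-s) =
        (γ : ℂ) / (s - (α : ℂ)) ^ m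
          + (∑ j ∈ Finset.Icc 1 (m - 1), ν j / (s - (α : ℂ)) ^ j) + Φ s)
    (β : ℝ) (hβ : -α < β) :
    Asymptotics.IsEquivalent Filter.atTop
      (fun N : ℕ => ∑ δ ∈ Finset.Icc 1 N, (δ : ℝ) ^ β * (aCount G δ : ℝ))
      (fun N : ℕ =>
        (γ / ((Nat.factorial (m - 1) : ℝ) * (α + β))) *
          (N : ℝ) ^ (α + β) * Real.log N ^ (m - 1)) := by
  obtain ⟨k, rfl⟩ := Nat.exists_eq_add_of_le' hm
  rw [Nat.add_sub_cancel] at *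
  have hc : 0 < α + β := by linarith
  have hlim := tendsto_expSummatory_div_pow (c := α + β) (γ := γ) (k := k) (ν := ν)
    (f := fun n => ((n + 1 : ℕ) : ℝ) ^ β * aCount G (n + 1)) (Ψ := fun z => Φ (α + z)) hc
    (fun n => by positivity) ?_ ?_ ?_
  · have hlim' := hlim.comp (Real.tendsto_log_atTop.comp tendsto_natCast_atTop_atTop)
    have hC : γ / (α + β) / k.factorial ≠ 0 := by positivity
    refine Asymptotics.isEquivalent_of_tendsto_one ?_
    have := hlim'.div_const (γ / (α + β) / k.factorial)
    rw [div_self hC] at this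
    refine this.congr' ?_
    filter_upwards [eventually_gt_atTop 0] with N hN
    have hN' : (0 : ℝ) < N := Nat.cast_pos.2 hN
    have hNc := (Real.rpow_pos_of_pos hN' (α + β)).ne'
    simp only [Function.comp_apply, Pi.div_apply]
    rw [sum_Icc_eq_rpow_mul_expSummatory (fun n => (n : ℝ) ^ β * aCount G n) (α + β) hN,
      div_div, div_div, mul_assoc (γ / _), mul_left_comm (γ / _), mul_div_mul_left _ _ hNc]
    congr 1
    rw [mul_comm, mul_comm (α + β)]
  · intro ε hε
    refine (hsum ((α + ε : ℝ) : ℂ) (by simpa using hε)).congr fun n => ?_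
    rw [norm_mul, Complex.norm_natCast_cpow_of_pos n.succ_pos, Complex.norm_natCast,
      natCast_rpow_eq_exp, natCast_rpow_eq_exp, mul_right_comm, ← Real.exp_add, mul_comm]
    simp only [Complex.neg_re, Complex.ofReal_re]
    ring_nf
  · exact hΦc.comp (by fun_prop) fun z hz => by simpa using hz
  · intro z hz
    have h := hval (α + z) (by simpa using hz)
    rw [add_sub_cancel_left] at h
    rw [← h]
    refine tsum_congr fun n => ?_
    rw [natCast_cpow_eq_cexp, natCast_rpow_eq_exp]
    push_cast
    rw [mul_right_comm, ← Complex.exp_add, mul_comm]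
    ring_nf
end

section
/- Let K > 0 be real, α > 0 real, and m ≥ 1 an integer. Let W : (0,∞) → (0,∞) be a strictly decreasing continuous bijection such that W(u) ∼ K·u^{−α}·(−ln u)^{m−1} as u → 0⁺ (ratio tends to 1). Then the inverse function satisfies W^{−1}(w) ∼ K^{1/α} · α^{−(m−1)/α} · w^{−1/α} · (ln w)^{(m−1)/α} as w → ∞. -/
open Filter Topology Asymptotics

theorem Asymptotics.IsEquivalent.rpow_of_eventually_nonneg {ι : Type*} {u v : ι → ℝ}
    {l : Filter ι} (h : u ~[l] v) (hv : ∀ᶠ x in l, 0 ≤ v x) (r : ℝ) :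
    (fun x => u x ^ r) ~[l] (fun x => v x ^ r) := by
  have habs : v =ᶠ[l] fun x => |v x| := by
    filter_upwards [hv] with x hx using (abs_of_nonneg hx).symm
  refine ((h.congr_right habs).rpow (fun x => abs_nonneg (v x)) (r := r)).congr_right ?_
  filter_upwards [habs] with x hx
  simp [← hx]

theorem tendsto_neg_log_nhdsGT_zero :
    Tendsto (fun u : ℝ => -Real.log u) (𝓝[>] 0) atTop :=
  tendsto_neg_atBot_atTop.comp Real.tendsto_log_nhdsGT_zero

theorem isEquivalent_log_rpow_mul_neg_log_pow {K α : ℝ} (hK : 0 < K) (hα : 0 < α) (n : ℕ) :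
    (fun u : ℝ => Real.log (K * u ^ (-α) * (-Real.log u) ^ n)) ~[𝓝[>] 0]
      (fun u : ℝ => α * -Real.log u) := by
  have hL := tendsto_neg_log_nhdsGT_zero
  have hlog : (fun u : ℝ => (n : ℝ) * Real.log (-Real.log u)) =o[𝓝[>] 0]
      (fun u : ℝ => α * -Real.log u) :=
    ((Real.isLittleO_log_id_atTop.comp_tendsto hL).const_mul_left _).const_mul_right hα.ne'
  have hconst : (fun _ : ℝ => Real.log K) =o[𝓝[>] 0] (fun u : ℝ => α * -Real.log u) :=
    isLittleO_const_left.mpr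
      (Or.inr (tendsto_norm_atTop_atTop.comp (hL.const_mul_atTop hα)))
  refine ((IsEquivalent.refl.add_isLittleO hlog).add_isLittleO hconst).congr_left ?_
  filter_upwards [hL.eventually_gt_atTop 0, self_mem_nhdsWithin] with u hu hu0
  have hu0 : 0 < u := hu0
  have hrpow := Real.rpow_pos_of_pos hu0 (-α)
  simp only [Pi.add_apply]
  rw [Real.log_mul (by positivity) (by positivity), Real.log_mul hK.ne' hrpow.ne',
    Real.log_rpow hu0, Real.log_pow]
  ring

theorem StrictAntiOn.tendsto_rightInverse_nhdsGT_zero {W Winv : ℝ → ℝ}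
    (hW : StrictAntiOn W (Set.Ioi 0))
    (hinv : ∀ w : ℝ, 0 < w → Winv w ∈ Set.Ioi (0 : ℝ) ∧ W (Winv w) = w) :
    Tendsto Winv atTop (𝓝[>] 0) := by
  have hpos : ∀ᶠ w in atTop, 0 < Winv w := by
    filter_upwards [eventually_gt_atTop 0] with w hw using (hinv w hw).1
  refine tendsto_nhdsWithin_iff.mpr ⟨tendsto_order.mpr ⟨fun a ha => ?_, fun a ha => ?_⟩, hpos⟩
  · filter_upwards [hpos] with w hw using ha.trans hw
  · filter_upwards [eventually_gt_atTop 0, eventually_gt_atTop (W a)] with w hw hwa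
    obtain ⟨hmem, heq⟩ := hinv w hw
    rw [← heq] at hwa
    exact (hW.lt_iff_gt ha hmem).mp hwa


theorem inverse_function_asymptotics
    (K α : ℝ) (hK : 0 < K) (hα : 0 < α) (m : ℕ) (hm : 1 ≤ m)
    (W Winv : ℝ → ℝ)
    (hWanti : StrictAntiOn W (Set.Ioi 0))
    (hWcont : ContinuousOn W (Set.Ioi 0))
    (hWbij : Set.BijOn W (Set.Ioi 0) (Set.Ioi 0))
    (hWasym : Asymptotics.IsEquivalent (nhdsWithin 0 (Set.Ioi 0)) W
      (fun u : ℝ => K * u ^ (-α) * (-Real.log u) ^ (m - 1)))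
    (hWinv : ∀ w : ℝ, 0 < w → Winv w ∈ Set.Ioi (0 : ℝ) ∧ W (Winv w) = w) :
    Asymptotics.IsEquivalent Filter.atTop Winv
      (fun w : ℝ => K ^ (1 / α) * α ^ (-(((m : ℝ) - 1) / α)) *
        w ^ (-(1 / α)) * Real.log w ^ (((m : ℝ) - 1) / α)) := by
  have hW0 := hWanti.tendsto_rightInverse_nhdsGT_zero hWinv
  have hn : ((m - 1 : ℕ) : ℝ) = (m : ℝ) - 1 := by rw [Nat.cast_sub hm, Nat.cast_one]
  rw [← hn]
  set n := m - 1
  have hL : Tendsto (fun w => -Real.log (Winv w)) atTop atTop :=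
    tendsto_neg_log_nhdsGT_zero.comp hW0
  have hid : (fun w : ℝ => K * Winv w ^ (-α) * (-Real.log (Winv w)) ^ n) ~[atTop]
      (fun w : ℝ => w) := by
    refine ((hWasym.comp_tendsto hW0).congr_left ?_).symm
    filter_upwards [eventually_gt_atTop 0] with w hw using (hWinv w hw).2
  have hlog : (fun w : ℝ => α * -Real.log (Winv w)) ~[atTop] Real.log :=
    ((isEquivalent_log_rpow_mul_neg_log_pow hK hα n).comp_tendsto hW0).symm.trans
      (hid.log tendsto_id)
  have hpow := hid.rpow_of_eventually_nonneg (eventually_ge_atTop 0) (-(1 / α))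
  have hlogpow := hlog.rpow_of_eventually_nonneg
    (Real.tendsto_log_atTop.eventually_ge_atTop 0) (n / α)
  refine (((IsEquivalent.refl (u := fun _ : ℝ => K ^ (1 / α) * α ^ (-((n : ℝ) / α)))).mul
    hpow).mul hlogpow).congr_left ?_
  filter_upwards [hL.eventually_gt_atTop 0, eventually_gt_atTop 0] with w hLw hw
  have hu : 0 < Winv w := (hWinv w hw).1
  simp only [Pi.mul_apply]
  generalize -Real.log (Winv w) = L at hLw
  rw [Real.mul_rpow (by positivity) (by positivity), Real.mul_rpow hK.le (by positivity),
    Real.mul_rpow hα.le hLw.le, ← Real.rpow_mul hu.le, ← Real.rpow_natCast L n,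
    ← Real.rpow_mul hLw.le, show -α * -(1 / α) = 1 by field_simp,
    show (n : ℝ) * -(1 / α) = -(n / α) by ring, Real.rpow_one, Real.rpow_neg hK.le,
    Real.rpow_neg hα.le, Real.rpow_neg hLw.le]
  field_simp
end
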